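/- arXiv:1002.4664 — 2 statements merged into one kernel-verified Lean document; each statement's English description precedes it below -/
import Mathlib

section
/- Let 1 < p < n, x₀ ∈ ℝⁿ, and suppose ∫_0^1 (σ(B(x₀,r))/r^{n−p}) dr/r < ∞. Let C(σ) = sup_E σ(E)/cap_{1,p}(E), the supremum over compact sets E of positive capacity, and assume C(σ) < ∞. Fix constants B, c > 0 and define v(x) = B·|x−x₀|^{(p−n)/(p−1)} · exp( c ∫_0^{|x−x₀|} (σ(B(x,r))/r^{n−p})^{1/(p−1)} dr/r + c ∫_0^{|x−x₀|} (σ(B(x₀,r))/r^{n−p}) dr/r ). Then there exists a constant C₀ > 0, depending only on n, p and c, such that if C(σ) < C₀, then v ∈ L^p_loc(ℝⁿ \ {x₀}) with respect to Lebesgue measure; that is, ∫_K v^p dx < ∞ for every compact set K ⊂ ℝⁿ \ {x₀}. -/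
open MeasureTheory Metric Set Filter
open scoped ENNReal NNReal Topology

noncomputable section

/-- `n`-dimensional Euclidean space. -/
abbrev En (n : ℕ) : Type := EuclideanSpace ℝ (Fin n)

/-- The truncated Wolff potential
`W^ρ_{α,s} μ (x) = ∫_0^ρ (μ(B(x,r))/r^{n-αs})^{1/(s-1)} dr/r`. -/
noncomputable def wolffT (n : ℕ) (α s : ℝ) (μ : Measure (En n)) (ρ : ℝ) (x : En n) : ℝ≥0∞ :=
  ∫⁻ r in Set.Ioo (0:ℝ) ρ,
    (μ (Metric.ball x r) / ENNReal.ofReal (r ^ ((n:ℝ) - α * s))) ^ (1/(s-1))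
      * ENNReal.ofReal r⁻¹

/-- The (full) Wolff potential
`W_{α,s} μ (x) = ∫_0^∞ (μ(B(x,r))/r^{n-αs})^{1/(s-1)} dr/r`. -/
noncomputable def wolff (n : ℕ) (α s : ℝ) (μ : Measure (En n)) (x : En n) : ℝ≥0∞ :=
  ∫⁻ r in Set.Ioi (0:ℝ),
    (μ (Metric.ball x r) / ENNReal.ofReal (r ^ ((n:ℝ) - α * s))) ^ (1/(s-1))
      * ENNReal.ofReal r⁻¹

/-- The truncated Riesz-type potential
`I^ρ μ (x) = ∫_0^ρ (μ(B(x,r))/r^{n-αs}) dr/r`. -/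
noncomputable def rieszT (n : ℕ) (α s : ℝ) (μ : Measure (En n)) (ρ : ℝ) (x : En n) : ℝ≥0∞ :=
  ∫⁻ r in Set.Ioo (0:ℝ) ρ,
    (μ (Metric.ball x r) / ENNReal.ofReal (r ^ ((n:ℝ) - α * s))) * ENNReal.ofReal r⁻¹

/-- The nonlinear operator `𝒩 f (x) = W_{α,s}(f^{s-1} dσ)(x)`. -/
noncomputable def Nop (n : ℕ) (α s : ℝ) (σ : Measure (En n)) (f : En n → ℝ≥0∞) (x : En n) :
    ℝ≥0∞ :=
  ∫⁻ r in Set.Ioi (0:ℝ),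
    (ENNReal.ofReal (r ^ (α * s - (n:ℝ))) * ∫⁻ y in Metric.ball x r, (f y) ^ (s-1) ∂σ)
        ^ (1/(s-1))
      * ENNReal.ofReal r⁻¹

/-- The Riesz potential `I_α f (x) = (n-α)⁻¹ ∫ f(y) |x-y|^{α-n} dy`. -/
noncomputable def rieszPot (n : ℕ) (α : ℝ) (f : En n → ℝ≥0∞) (x : En n) : ℝ≥0∞ :=
  ENNReal.ofReal (((n:ℝ) - α)⁻¹) * ∫⁻ y, f y * ENNReal.ofReal (‖x - y‖ ^ (α - (n:ℝ)))

/-- The Riesz capacity `cap_{α,s}(A) = inf { ∫ f^s : f ≥ 0, I_α f ≥ 1 on A }`. -/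
noncomputable def rieszCap (n : ℕ) (α s : ℝ) (A : Set (En n)) : ℝ≥0∞ :=
  ⨅ (f : En n → ℝ≥0∞) (_ : Measurable f) (_ : ∀ x ∈ A, 1 ≤ rieszPot n α f x),
    ∫⁻ y, (f y) ^ s

/-- Extended exponential: `eexp x = exp x` for finite `x`, with `eexp ∞ = ∞`. -/
noncomputable def eexp (x : ℝ≥0∞) : ℝ≥0∞ :=
  if x = ∞ then ∞ else ENNReal.ofReal (Real.exp x.toReal)

/-- The function `v(x) = B |x-x₀|^{(p-n)/(p-1)}
  exp(c ∫_0^{|x-x₀|} (σ(B(x,r))/r^{n-p})^{1/(p-1)} dr/r + c ∫_0^{|x-x₀|} σ(B(x₀,r))/r^{n-p} dr/r)`. -/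
noncomputable def vp (n : ℕ) (p B c : ℝ) (σ : Measure (En n)) (x₀ x : En n) : ℝ≥0∞ :=
  ENNReal.ofReal B * (ENNReal.ofReal ‖x - x₀‖) ^ ((p-(n:ℝ))/(p-1))
    * eexp (ENNReal.ofReal c * wolffT n 1 p σ ‖x - x₀‖ x
        + ENNReal.ofReal c * rieszT n 1 p σ ‖x - x₀‖ x₀)

lemma rieszCap_closedBall_le {n : ℕ} (hn : 2 ≤ n) {p : ℝ} (hp : 1 < p) :
    ∃ A : ℝ, 0 < A ∧ ∀ (x : En n) (r : ℝ), 0 < r →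
      rieszCap n 1 p (closedBall x r) ≤ ENNReal.ofReal (A * r ^ ((n : ℝ) - p)) := by
  have hn' : (2 : ℝ) ≤ n := by exact_mod_cast hn
  have : Nonempty (Fin n) := ⟨⟨0, by omega⟩⟩
  set ω : ℝ := (volume (ball (0 : En n) 1)).toReal with hω
  have hωpos : 0 < ω :=
    ENNReal.toReal_pos (measure_ball_pos _ _ one_pos).ne' measure_ball_lt_top.ne
  have hvol : ∀ (x : En n) (r : ℝ), 0 < r →
      volume (closedBall x r) = ENNReal.ofReal (r ^ (n : ℝ) * ω) := by
    intro x r hr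
    rw [Measure.addHaar_closedBall _ _ hr.le, ENNReal.ofReal_mul (by positivity), hω,
      ENNReal.ofReal_toReal measure_ball_lt_top.ne, finrank_euclideanSpace_fin, Real.rpow_natCast]
  set κ : ℝ := ((n : ℝ) - 1)⁻¹ * 2 ^ ((1 : ℝ) - n) * ω with hκ
  have hn1 : 0 < (n : ℝ) - 1 := by linarith
  have hκpos : 0 < κ := by positivity
  refine ⟨κ⁻¹ ^ p * ω, by positivity, fun x r hr => ?_⟩
  set f : En n → ℝ≥0∞ :=
    (closedBall x r).indicator (fun _ => ENNReal.ofReal ((κ * r)⁻¹)) with hf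
  have hfm : Measurable f := measurable_const.indicator measurableSet_closedBall
  have hpot : ∀ y ∈ closedBall x r, 1 ≤ rieszPot n 1 f y := by
    intro y hy
    have hint : ENNReal.ofReal ((κ * r)⁻¹ * (2 * r) ^ ((1 : ℝ) - n)) *
          ENNReal.ofReal (r ^ (n : ℝ) * ω)
        ≤ ∫⁻ z, f z * ENNReal.ofReal (‖y - z‖ ^ ((1 : ℝ) - n)) := by
      calc _ = ∫⁻ _ in closedBall x r \ {y},
              ENNReal.ofReal ((κ * r)⁻¹ * (2 * r) ^ ((1 : ℝ) - n)) := by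
            rw [setLIntegral_const, measure_sdiff_null (measure_singleton y), hvol x r hr]
        _ ≤ ∫⁻ z in closedBall x r \ {y}, f z * ENNReal.ofReal (‖y - z‖ ^ ((1 : ℝ) - n)) := by
            refine setLIntegral_mono' (measurableSet_closedBall.diff (measurableSet_singleton y)) ?_
            rintro z ⟨hz, hzy⟩
            rw [hf, indicator_of_mem hz, ← ENNReal.ofReal_mul (by positivity)]
            refine ENNReal.ofReal_le_ofReal (mul_le_mul_of_nonneg_left ?_ (by positivity))
            have hpos : 0 < ‖y - z‖ := norm_pos_iff.2 (sub_ne_zero.2 fun h => hzy h.symm)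
            refine Real.rpow_le_rpow_of_nonpos hpos ?_ (by linarith)
            rw [← dist_eq_norm]
            have := dist_triangle_right y z x
            rw [mem_closedBall] at hy hz
            linarith
        _ ≤ _ := setLIntegral_le_lintegral _ _
    refine le_trans (le_of_eq ?_) (mul_le_mul_right hint _)
    rw [← ENNReal.ofReal_mul (by positivity), ← ENNReal.ofReal_mul (by positivity),
      ← ENNReal.ofReal_one]
    congr 1
    rw [hκ, Real.mul_rpow two_pos.le hr.le, Real.rpow_sub hr, Real.rpow_one]
    have : r ^ (n : ℝ) ≠ 0 := (Real.rpow_pos_of_pos hr _).ne'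
    have h2 : (2 : ℝ) ^ ((1 : ℝ) - n) ≠ 0 := (Real.rpow_pos_of_pos two_pos _).ne'
    field_simp
  refine (iInf₂_le_of_le f hfm (iInf_le _ hpot)).trans (le_of_eq ?_)
  have hfp : (fun y => f y ^ p) =
      (closedBall x r).indicator (fun _ => ENNReal.ofReal ((κ * r)⁻¹ ^ p)) := by
    ext y
    by_cases hy : y ∈ closedBall x r
    · simp only [hf, indicator_of_mem hy]
      rw [ENNReal.ofReal_rpow_of_nonneg (by positivity) (by linarith)]
    · simp only [hf, indicator_of_notMem hy]
      exact ENNReal.zero_rpow_of_pos (by linarith)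
  rw [hfp, lintegral_indicator measurableSet_closedBall, setLIntegral_const, hvol x r hr,
    ← ENNReal.ofReal_mul (by positivity)]
  congr 1
  rw [mul_inv, Real.mul_rpow (by positivity) (by positivity), Real.inv_rpow hr.le,
    Real.rpow_sub hr]
  ring

/-- Hedberg-type splitting: a uniformly bounded density whose weighted integral `M` is finite has
logarithmically bounded integral in terms of `M`. -/
lemma lintegral_inv_le_log {g : ℝ → ℝ≥0∞} {δ s R : ℝ} (hδ : 0 ≤ δ) (hs : 0 < s) (hR : 0 < R)
    (hg : ∀ r, 0 < r → g r ≤ ENNReal.ofReal δ) {M : ℝ≥0∞} (hM : M ≠ ∞)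
    (hMg : ∫⁻ r in Ioo 0 R, g r * ENNReal.ofReal ((R / r) ^ s) * ENNReal.ofReal r⁻¹ ≤ M) :
    ∫⁻ r in Ioo 0 R, g r * ENNReal.ofReal r⁻¹
      ≤ ENNReal.ofReal (1 + δ / s * Real.log (max 1 M.toReal)) := by
  set N := max 1 M.toReal with hN
  have hN1 : 1 ≤ N := le_max_left _ _
  have hN0 : 0 < N := by linarith
  set t := R * N ^ (-s⁻¹) with ht
  have ht0 : 0 < t := by positivity
  have htR : t ≤ R := mul_le_of_le_one_right hR.le
    (Real.rpow_le_one_of_one_le_of_nonpos hN1 (by simp [hs.le]))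
  have hRt : R / t = N ^ s⁻¹ := by
    rw [ht, Real.rpow_neg hN0.le]
    field_simp
  have hsmall : ∫⁻ r in Ioo 0 t, g r * ENNReal.ofReal r⁻¹ ≤ 1 := by
    calc _ ≤ ∫⁻ r in Ioo 0 t, ENNReal.ofReal N⁻¹ *
            (g r * ENNReal.ofReal ((R / r) ^ s) * ENNReal.ofReal r⁻¹) := by
          refine setLIntegral_mono' measurableSet_Ioo fun r hr => ?_
          have h1 : N ≤ (R / r) ^ s := by
            calc N = (R / t) ^ s := by
                  rw [hRt, ← Real.rpow_mul hN0.le, inv_mul_cancel₀ hs.ne', Real.rpow_one]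
              _ ≤ _ := Real.rpow_le_rpow (by positivity)
                  (div_le_div_of_nonneg_left hR.le hr.1 hr.2.le) hs.le
          have h2 : 1 ≤ ENNReal.ofReal N⁻¹ * ENNReal.ofReal ((R / r) ^ s) := by
            rw [← ENNReal.ofReal_mul (by positivity), ENNReal.one_le_ofReal]
            rw [inv_mul_eq_div, one_le_div hN0]
            exact h1
          calc g r * ENNReal.ofReal r⁻¹ = 1 * (g r * ENNReal.ofReal r⁻¹) := (one_mul _).symm
            _ ≤ (ENNReal.ofReal N⁻¹ * ENNReal.ofReal ((R / r) ^ s)) *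
                (g r * ENNReal.ofReal r⁻¹) := mul_le_mul_left h2 _
            _ = _ := by ring
      _ = ENNReal.ofReal N⁻¹ *
            ∫⁻ r in Ioo 0 t, (g r * ENNReal.ofReal ((R / r) ^ s) * ENNReal.ofReal r⁻¹) :=
          lintegral_const_mul' _ _ ENNReal.ofReal_ne_top
      _ ≤ ENNReal.ofReal N⁻¹ * ENNReal.ofReal N := by
          refine mul_le_mul_right ((lintegral_mono_set (Ioo_subset_Ioo_right htR)).trans
            (hMg.trans ?_)) _
          rw [← ENNReal.ofReal_toReal hM]
          exact ENNReal.ofReal_le_ofReal (le_max_right _ _)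
      _ = 1 := by
          rw [← ENNReal.ofReal_mul (by positivity), inv_mul_cancel₀ hN0.ne', ENNReal.ofReal_one]
  have hlarge : ∫⁻ r in Ioc t R, g r * ENNReal.ofReal r⁻¹
      ≤ ENNReal.ofReal (δ / s * Real.log N) := by
    calc _ ≤ ∫⁻ r in Ioc t R, ENNReal.ofReal δ * ENNReal.ofReal r⁻¹ :=
          setLIntegral_mono' measurableSet_Ioc fun r hr =>
            mul_le_mul_left (hg r (ht0.trans hr.1)) _
      _ = ENNReal.ofReal δ * ∫⁻ r in Ioc t R, ENNReal.ofReal r⁻¹ :=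
          lintegral_const_mul' _ _ ENNReal.ofReal_ne_top
      _ = ENNReal.ofReal δ * ENNReal.ofReal (Real.log (R / t)) := by
          rw [← integral_inv_of_pos ht0 hR, intervalIntegral.integral_of_le htR,
            ofReal_integral_eq_lintegral_ofReal]
          · refine (intervalIntegrable_iff_integrableOn_Ioc_of_le htR).1 ?_
            refine intervalIntegral.intervalIntegrable_inv (fun r hr => ?_) continuousOn_id
            rw [uIcc_of_le htR] at hr
            exact (ht0.trans_le hr.1).ne'
          · filter_upwards [ae_restrict_mem measurableSet_Ioc] with r hr
            exact inv_nonneg.2 (ht0.trans hr.1).le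
      _ = _ := by
          rw [← ENNReal.ofReal_mul hδ, hRt, Real.log_rpow hN0]
          congr 1
          ring
  have hsub : Ioo 0 R ⊆ (Ioo 0 t ∪ {t}) ∪ Ioc t R := by
    intro r hr
    rcases lt_trichotomy r t with h | h | h
    · exact Or.inl (Or.inl ⟨hr.1, h⟩)
    · exact Or.inl (Or.inr h)
    · exact Or.inr ⟨h, hr.2.le⟩
  calc _ ≤ ∫⁻ r in (Ioo 0 t ∪ {t}) ∪ Ioc t R, g r * ENNReal.ofReal r⁻¹ := lintegral_mono_set hsub
    _ ≤ ((∫⁻ r in Ioo 0 t, g r * ENNReal.ofReal r⁻¹) + ∫⁻ r in {t}, g r * ENNReal.ofReal r⁻¹)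
          + ∫⁻ r in Ioc t R, g r * ENNReal.ofReal r⁻¹ :=
        (lintegral_union_le _ _ _).trans (add_le_add (lintegral_union_le _ _ _) le_rfl)
    _ ≤ (1 + 0) + ENNReal.ofReal (δ / s * Real.log N) := by
        refine add_le_add (add_le_add hsmall ?_) hlarge
        simp [Measure.restrict_singleton]
    _ = _ := by
        rw [add_zero, ENNReal.ofReal_add zero_le_one
          (mul_nonneg (by positivity) (Real.log_nonneg hN1)), ENNReal.ofReal_one]

lemma rpow_le_of_le_ofReal {a : ℝ≥0∞} {ε t q m : ℝ} (hε : 0 < ε) (ht : 0 < t) (hm : 0 < m)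
    (hm1 : m ≤ 1) (hmq : m ≤ q) (ha : a ≤ ENNReal.ofReal ε) :
    a ^ q ≤ ENNReal.ofReal (ε ^ (q - m)) *
      (ENNReal.ofReal (t ^ (m - 1)) * a + ENNReal.ofReal (t ^ m)) := by
  have hq : 0 < q := hm.trans_le hmq
  obtain ⟨b, hb, rfl⟩ : ∃ b : ℝ, 0 ≤ b ∧ a = ENNReal.ofReal b :=
    ⟨a.toReal, ENNReal.toReal_nonneg,
      (ENNReal.ofReal_toReal (ha.trans_lt ENNReal.ofReal_lt_top).ne).symm⟩
  rw [ENNReal.ofReal_le_ofReal_iff hε.le] at ha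
  rw [ENNReal.ofReal_rpow_of_nonneg hb hq.le, ← ENNReal.ofReal_mul (by positivity),
    ← ENNReal.ofReal_add (by positivity) (by positivity), ← ENNReal.ofReal_mul (by positivity)]
  refine ENNReal.ofReal_le_ofReal ?_
  rcases hb.eq_or_lt with rfl | hb
  · rw [Real.zero_rpow hq.ne']
    positivity
  have hsplit : b ^ m ≤ t ^ (m - 1) * b + t ^ m := by
    rcases le_total b t with h | h
    · have := Real.rpow_le_rpow hb.le h hm.le
      have : 0 ≤ t ^ (m - 1) * b := by positivity
      linarith
    · have h1 := Real.rpow_le_rpow_of_nonpos ht h (by linarith : m - 1 ≤ 0)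
      have h2 : b ^ m = b ^ (m - 1) * b := by
        rw [← Real.rpow_add_one hb.ne', sub_add_cancel]
      have : 0 ≤ t ^ m := by positivity
      nlinarith
  calc b ^ q = b ^ (q - m) * b ^ m := by rw [← Real.rpow_add hb, sub_add_cancel]
    _ ≤ _ := mul_le_mul (Real.rpow_le_rpow hb.le ha (by linarith)) hsplit
        (by positivity) (by positivity)

lemma measurable_measure_ball {n : ℕ} (σ : Measure (En n)) [SFinite σ] :
    Measurable fun z : En n × ℝ => σ (ball z.1 z.2) := by
  have hs : MeasurableSet {w : (En n × ℝ) × En n | dist w.2 w.1.1 < w.1.2} :=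
    (isOpen_lt (by fun_prop) (by fun_prop)).measurableSet
  exact measurable_measure_prodMk_left hs

lemma setLIntegral_measure_ball_le {n : ℕ} (σ : Measure (En n)) [SFinite σ] (x₀ : En n)
    {r R : ℝ} (hr : 0 < r) (hrR : r ≤ R) :
    ∫⁻ x in closedBall x₀ R, σ (ball x r)
      ≤ ENNReal.ofReal (r ^ (n : ℝ)) * (volume (ball (0 : En n) 1) * σ (ball x₀ (2 * R))) := by
  obtain ⟨T, hT, hTm⟩ : ∃ T : Set (En n × En n), MeasurableSet T ∧
      ∀ x y, (x, y) ∈ T ↔ dist y x < r :=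
    ⟨{w | dist w.2 w.1 < r}, (isOpen_lt (by fun_prop) (by fun_prop)).measurableSet,
      fun _ _ => Iff.rfl⟩
  have hslice : ∀ x ∈ closedBall x₀ R,
      σ (ball x r) ≤ ∫⁻ y in ball x₀ (2 * R), T.indicator 1 (x, y) ∂σ := by
    intro x hx
    have hsub : ball x r ⊆ ball x₀ (2 * R) :=
      ball_subset_ball' (by linarith [mem_closedBall.1 hx])
    calc σ (ball x r) = ∫⁻ y in ball x r, 1 ∂σ := (setLIntegral_one _).symm
      _ = ∫⁻ y in ball x r, T.indicator 1 (x, y) ∂σ :=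
          setLIntegral_congr_fun measurableSet_ball fun y hy =>
            (indicator_of_mem ((hTm x y).2 hy) (1 : En n × En n → ℝ≥0∞)).symm
      _ ≤ _ := lintegral_mono_set hsub
  have hcoslice : ∀ y, ∫⁻ x in closedBall x₀ R, T.indicator 1 (x, y)
      ≤ ENNReal.ofReal (r ^ (n : ℝ)) * volume (ball (0 : En n) 1) := by
    intro y
    refine (setLIntegral_le_lintegral _ _).trans ?_
    have : (fun x => T.indicator (1 : En n × En n → ℝ≥0∞) (x, y)) = (ball y r).indicator 1 := by
      ext x
      simp only [indicator, hTm, mem_ball, dist_comm x y, Pi.one_apply]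
    rw [this, lintegral_indicator_one measurableSet_ball,
      Measure.addHaar_ball_of_pos _ _ hr, finrank_euclideanSpace_fin, Real.rpow_natCast]
  calc _ ≤ ∫⁻ x in closedBall x₀ R, ∫⁻ y in ball x₀ (2 * R), T.indicator 1 (x, y) ∂σ :=
        setLIntegral_mono' measurableSet_closedBall hslice
    _ = ∫⁻ y in ball x₀ (2 * R), (∫⁻ x in closedBall x₀ R, T.indicator 1 (x, y)) ∂σ :=
        lintegral_lintegral_swap (f := fun x y => T.indicator 1 (x, y))
          (measurable_one.indicator hT).aemeasurable
    _ ≤ ∫⁻ _ in ball x₀ (2 * R),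
          ENNReal.ofReal (r ^ (n : ℝ)) * volume (ball (0 : En n) 1) ∂σ :=
        lintegral_mono hcoslice
    _ = _ := by rw [setLIntegral_const, mul_assoc]

lemma lintegral_weighted_density_lt_top {n : ℕ} {p q m s ε R : ℝ} (σ : Measure (En n))
    [IsLocallyFiniteMeasure σ] (x₀ : En n) (hε : 0 < ε) (hm : 0 < m) (hm1 : m ≤ 1) (hmq : m ≤ q)
    (hs : s < p * m) (hR : 0 < R)
    (hσ : ∀ x r, 0 < r → σ (ball x r) / ENNReal.ofReal (r ^ ((n : ℝ) - 1 * p)) ≤ ENNReal.ofReal ε) :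
    ∫⁻ x in closedBall x₀ R, ∫⁻ r in Ioo 0 R,
      (σ (ball x r) / ENNReal.ofReal (r ^ ((n : ℝ) - 1 * p))) ^ q * ENNReal.ofReal ((R / r) ^ s)
        * ENNReal.ofReal r⁻¹ < ∞ := by
  set S := volume (ball (0 : En n) 1) * σ (ball x₀ (2 * R)) with hS
  set L := ENNReal.ofReal (ε ^ (q - m)) * (S + volume (closedBall x₀ R)) with hL
  have hL_top : L ≠ ∞ := ENNReal.mul_ne_top ENNReal.ofReal_ne_top (ENNReal.add_ne_top.2
    ⟨ENNReal.mul_ne_top measure_ball_lt_top.ne measure_ball_lt_top.ne,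
      measure_closedBall_lt_top.ne⟩)
  have hball : Measurable fun z : En n × ℝ =>
      σ (ball z.1 z.2) / ENNReal.ofReal (z.2 ^ ((n : ℝ) - 1 * p)) :=
    (measurable_measure_ball σ).div (by fun_prop)
  have hslice : ∀ r ∈ Ioo 0 R, ∫⁻ x in closedBall x₀ R,
      (σ (ball x r) / ENNReal.ofReal (r ^ ((n : ℝ) - 1 * p))) ^ q
        ≤ ENNReal.ofReal (r ^ (p * m)) * L := by
    rintro r ⟨hr, hrR⟩
    have hav : ∫⁻ x in closedBall x₀ R, σ (ball x r) / ENNReal.ofReal (r ^ ((n : ℝ) - 1 * p))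
        ≤ ENNReal.ofReal (r ^ p) * S := by
      simp only [div_eq_mul_inv]
      rw [lintegral_mul_const' _ _ (by simp [Real.rpow_pos_of_pos hr])]
      refine (mul_le_mul_left (setLIntegral_measure_ball_le σ x₀ hr hrR.le) _).trans
        (le_of_eq ?_)
      rw [← ENNReal.ofReal_inv_of_pos (by positivity), mul_right_comm,
        ← ENNReal.ofReal_mul (by positivity), ← Real.rpow_neg hr.le, ← Real.rpow_add hr]
      congr 3
      ring
    calc _ ≤ ∫⁻ x in closedBall x₀ R, ENNReal.ofReal (ε ^ (q - m)) *
            (ENNReal.ofReal ((r ^ p) ^ (m - 1)) *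
              (σ (ball x r) / ENNReal.ofReal (r ^ ((n : ℝ) - 1 * p)))
              + ENNReal.ofReal ((r ^ p) ^ m)) :=
          lintegral_mono fun x => rpow_le_of_le_ofReal hε (by positivity) hm hm1 hmq (hσ x r hr)
      _ = ENNReal.ofReal (ε ^ (q - m)) * (ENNReal.ofReal ((r ^ p) ^ (m - 1)) *
            (∫⁻ x in closedBall x₀ R, σ (ball x r) / ENNReal.ofReal (r ^ ((n : ℝ) - 1 * p)))
              + ENNReal.ofReal ((r ^ p) ^ m) * volume (closedBall x₀ R)) := by
          rw [lintegral_const_mul' _ _ ENNReal.ofReal_ne_top,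
            lintegral_add_right _ measurable_const,
            lintegral_const_mul' _ _ ENNReal.ofReal_ne_top, setLIntegral_const]
      _ ≤ ENNReal.ofReal (ε ^ (q - m)) * (ENNReal.ofReal ((r ^ p) ^ (m - 1)) *
            (ENNReal.ofReal (r ^ p) * S)
              + ENNReal.ofReal ((r ^ p) ^ m) * volume (closedBall x₀ R)) := by gcongr
      _ = _ := by
          have hrp : 0 < r ^ p := Real.rpow_pos_of_pos hr p
          rw [← mul_assoc (ENNReal.ofReal ((r ^ p) ^ (m - 1))),
            ← ENNReal.ofReal_mul (by positivity), ← Real.rpow_add_one hrp.ne', sub_add_cancel,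
            ← Real.rpow_mul hr.le, hL]
          ring
  have hmeas : Measurable (Function.uncurry fun (x : En n) (r : ℝ) =>
      (σ (ball x r) / ENNReal.ofReal (r ^ ((n : ℝ) - 1 * p))) ^ q * ENNReal.ofReal ((R / r) ^ s)
        * ENNReal.ofReal r⁻¹) :=
    ((hball.pow_const q).mul (by fun_prop)).mul (by fun_prop)
  rw [lintegral_lintegral_swap hmeas.aemeasurable]
  calc _ ≤ ∫⁻ r in Ioo 0 R, (L * ENNReal.ofReal (R ^ s)) *
          ENNReal.ofReal (r ^ (p * m - s - 1)) := by
        refine setLIntegral_mono' measurableSet_Ioo fun r hr => ?_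
        rw [lintegral_mul_const' _ _ ENNReal.ofReal_ne_top,
          lintegral_mul_const' _ _ ENNReal.ofReal_ne_top]
        refine (mul_le_mul_left (mul_le_mul_left (hslice r hr) _) _).trans (le_of_eq ?_)
        have hr0 := hr.1
        rw [Real.div_rpow hR.le hr0.le, div_eq_mul_inv, ENNReal.ofReal_mul (by positivity),
          Real.rpow_sub_one hr0.ne', Real.rpow_sub hr0, div_eq_mul_inv, div_eq_mul_inv,
          ENNReal.ofReal_mul (by positivity), ENNReal.ofReal_mul (by positivity)]
        ring
    _ = L * ENNReal.ofReal (R ^ s) * ∫⁻ r in Ioo 0 R, ENNReal.ofReal (r ^ (p * m - s - 1)) :=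
        lintegral_const_mul' _ _ (ENNReal.mul_ne_top hL_top ENNReal.ofReal_ne_top)
    _ < ∞ := by
        refine ENNReal.mul_lt_top
          (ENNReal.mul_lt_top hL_top.lt_top ENNReal.ofReal_lt_top) ?_
        have hint : IntegrableOn (fun r : ℝ => r ^ (p * m - s - 1)) (Ioo 0 R) :=
          (intervalIntegral.integrableOn_Ioo_rpow_iff hR).2 (by linarith)
        exact hint.lintegral_lt_top

lemma eexp_le_ofReal_exp {x : ℝ≥0∞} {y : ℝ} (hy : 0 ≤ y) (h : x ≤ ENNReal.ofReal y) :
    eexp x ≤ ENNReal.ofReal (Real.exp y) := by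
  rw [eexp, if_neg (h.trans_lt ENNReal.ofReal_lt_top).ne]
  exact ENNReal.ofReal_le_ofReal (Real.exp_le_exp.2 (ENNReal.toReal_le_of_le_ofReal hy h))

lemma rieszT_lt_top {n : ℕ} {α s : ℝ} (μ : Measure (En n)) [IsLocallyFiniteMeasure μ]
    {x : En n} (h : rieszT n α s μ 1 x < ∞) (R : ℝ) : rieszT n α s μ R x < ∞ := by
  have hcont : ContinuousOn (fun r : ℝ => (r ^ ((n : ℝ) - α * s))⁻¹ * r⁻¹) (Icc 1 R) := by
    have h0 : ∀ r ∈ Icc (1 : ℝ) R, 0 < r := fun r hr => one_pos.trans_le hr.1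
    refine ContinuousOn.mul (ContinuousOn.inv₀ (continuousOn_id.rpow_const ?_) ?_)
      (continuousOn_id.inv₀ fun r hr => (h0 r hr).ne')
    · exact fun r hr => Or.inl (h0 r hr).ne'
    · exact fun r hr => (Real.rpow_pos_of_pos (h0 r hr) _).ne'
  have hint := (hcont.integrableOn_Icc (μ := volume)).lintegral_lt_top
  have hsub : Ioo 0 R ⊆ (Ioo 0 1 : Set ℝ) ∪ Icc 1 R := fun r hr =>
    (lt_or_ge r 1).imp (fun h => ⟨hr.1, h⟩) (fun h => ⟨h, hr.2.le⟩)
  refine (lintegral_mono_set hsub).trans_lt ((lintegral_union_le _ _ _).trans_lt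
    (ENNReal.add_lt_top.2 ⟨h, ?_⟩))
  calc _ ≤ ∫⁻ r in Icc 1 R, μ (ball x R) *
          ENNReal.ofReal ((r ^ ((n : ℝ) - α * s))⁻¹ * r⁻¹) := by
        refine setLIntegral_mono' measurableSet_Icc fun r hr => ?_
        have hr0 : 0 < r := one_pos.trans_le hr.1
        rw [div_eq_mul_inv, ← ENNReal.ofReal_inv_of_pos (by positivity), mul_assoc,
          ← ENNReal.ofReal_mul (by positivity)]
        exact mul_le_mul_left (measure_mono (ball_subset_ball hr.2)) _
    _ = μ (ball x R) * ∫⁻ r in Icc 1 R, ENNReal.ofReal ((r ^ ((n : ℝ) - α * s))⁻¹ * r⁻¹) :=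
        lintegral_const_mul' _ _ measure_ball_lt_top.ne
    _ < ∞ := ENNReal.mul_lt_top measure_ball_lt_top hint

/-- Lemma `lplocest`: with `C(σ) = sup_E σ(E)/cap_{1,p}(E) < ∞` and
`∫_0^1 σ(B(x₀,r))/r^{n-p} dr/r < ∞`, there is `C₀ = C₀(n,p,c) > 0` such that if `C(σ) < C₀`
then `v ∈ L^p_loc(ℝⁿ \ {x₀})` with respect to Lebesgue measure. -/
theorem statement15 (n : ℕ) (hn : 2 ≤ n) (p : ℝ) (hp : 1 < p) (hpn : p < n)
    (B c : ℝ) (hB : 0 < B) (hc : 0 < c) :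
    ∃ C₀ : ℝ, 0 < C₀ ∧
      ∀ σ : Measure (En n), IsLocallyFiniteMeasure σ →
        ∀ (x₀ : En n) (Cσ : ℝ), 0 < Cσ →
          (∀ E : Set (En n), IsCompact E → σ E ≤ ENNReal.ofReal Cσ * rieszCap n 1 p E) →
          rieszT n 1 p σ 1 x₀ < ∞ →
          Cσ < C₀ →
          ∀ K : Set (En n), IsCompact K → x₀ ∉ K →
            ∫⁻ x in K, (vp n p B c σ x₀ x) ^ p ∂volume < ∞ := by
  obtain ⟨A, hA, hcap⟩ := rieszCap_closedBall_le hn hp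
  have hp0 : 0 < p := by linarith
  have hp1 : 0 < p - 1 := by linarith
  set q := 1 / (p - 1) with hq
  have hq0 : 0 < q := by positivity
  set m := min 1 q with hm
  have hm0 : 0 < m := lt_min one_pos hq0
  set s := p * m / 2 with hs
  have hs0 : 0 < s := by positivity
  refine ⟨(s / (c * p)) ^ q⁻¹ / A, by positivity, ?_⟩
  intro σ hσ x₀ Cσ hCσ hσcap hriesz hsmall K hK hx₀
  set ε := Cσ * A with hε
  have hε0 : 0 < ε := by positivity
  have hexp : p * c * (ε ^ q / s) ≤ 1 := by
    have h1 : ε ≤ (s / (c * p)) ^ q⁻¹ := ((lt_div_iff₀ hA).1 hsmall).le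
    have h2 := Real.rpow_le_rpow hε0.le h1 hq0.le
    rw [← Real.rpow_mul (by positivity), inv_mul_cancel₀ hq0.ne', Real.rpow_one,
      le_div_iff₀ (by positivity)] at h2
    rw [← mul_div_assoc, div_le_one hs0]
    linarith
  have hdens : ∀ x r, 0 < r →
      σ (ball x r) / ENNReal.ofReal (r ^ ((n : ℝ) - 1 * p)) ≤ ENNReal.ofReal ε := by
    intro x r hr
    have hrn : 0 < r ^ ((n : ℝ) - p) := Real.rpow_pos_of_pos hr _
    rw [one_mul, ENNReal.div_le_iff (by simpa using hrn) ENNReal.ofReal_ne_top]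
    calc σ (ball x r) ≤ σ (closedBall x r) := measure_mono ball_subset_closedBall
      _ ≤ ENNReal.ofReal Cσ * ENNReal.ofReal (A * r ^ ((n : ℝ) - p)) :=
          (hσcap _ (isCompact_closedBall x r)).trans (mul_le_mul_right (hcap x r hr) _)
      _ = _ := by
          rw [← ENNReal.ofReal_mul hCσ.le, ← ENNReal.ofReal_mul hε0.le, hε, mul_assoc]
  obtain ⟨R, hR0, hKR⟩ : ∃ R : ℝ, 0 < R ∧ K ⊆ closedBall x₀ R := by
    obtain ⟨R, hR⟩ := hK.isBounded.subset_closedBall x₀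
    exact ⟨max R 1, lt_max_of_lt_right one_pos,
      hR.trans (closedBall_subset_closedBall (le_max_left _ _))⟩
  obtain ⟨d, hd0, hKd⟩ : ∃ d : ℝ, 0 < d ∧ ∀ x ∈ K, d ≤ ‖x - x₀‖ := by
    obtain ⟨d, hd0, hd⟩ := Metric.isOpen_iff.1 hK.isClosed.isOpen_compl x₀ hx₀
    refine ⟨d, hd0, fun x hx => not_lt.1 fun h => hd ?_ hx⟩
    rwa [mem_ball, dist_eq_norm]
  set D := (rieszT n 1 p σ R x₀).toReal with hD
  have hDtop : rieszT n 1 p σ R x₀ ≠ ∞ := (rieszT_lt_top σ hriesz R).ne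
  have hD0 : 0 ≤ D := ENNReal.toReal_nonneg
  set M : En n → ℝ≥0∞ := fun x => ∫⁻ r in Ioo 0 R,
    (σ (ball x r) / ENNReal.ofReal (r ^ ((n : ℝ) - 1 * p))) ^ q * ENNReal.ofReal ((R / r) ^ s)
      * ENNReal.ofReal r⁻¹ with hM
  have hMint : ∫⁻ x in closedBall x₀ R, M x < ∞ :=
    lintegral_weighted_density_lt_top σ x₀ hε0 hm0 (min_le_left _ _) (min_le_right _ _)
      (by rw [hs]; exact half_lt_self (by positivity)) hR0 hdens
  set F := B * d ^ ((p - n) / (p - 1)) with hF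
  have hF0 : 0 < F := by positivity
  set L := ENNReal.ofReal (F ^ p * Real.exp (p * (c + c * D))) with hL
  have hpt : ∀ x ∈ K, vp n p B c σ x₀ x ^ p ≤ L * (1 + M x) := by
    intro x hx
    by_cases hMx : M x = ∞
    · have : L ≠ 0 := by
        rw [hL, ne_eq, ENNReal.ofReal_eq_zero, not_le]
        positivity
      rw [hMx, add_top, ENNReal.mul_top this]
      exact le_top
    have hxR : ‖x - x₀‖ ≤ R := by
      rw [← dist_eq_norm]
      exact hKR hx
    set N := max 1 (M x).toReal with hN
    have hN1 : 1 ≤ N := le_max_left _ _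
    have hN0 : 0 < N := by linarith
    have hlogN : 0 ≤ Real.log N := Real.log_nonneg hN1
    have hW : wolffT n 1 p σ ‖x - x₀‖ x ≤ ENNReal.ofReal (1 + ε ^ q / s * Real.log N) := by
      refine (lintegral_mono_set (Ioo_subset_Ioo_right hxR)).trans ?_
      refine lintegral_inv_le_log (by positivity) hs0 hR0 (fun r hr => ?_) hMx le_rfl
      rw [← ENNReal.ofReal_rpow_of_nonneg hε0.le hq0.le]
      exact ENNReal.rpow_le_rpow (hdens x r hr) hq0.le
    have hI : rieszT n 1 p σ ‖x - x₀‖ x₀ ≤ ENNReal.ofReal D := by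
      rw [hD, ENNReal.ofReal_toReal hDtop]
      exact lintegral_mono_set (Ioo_subset_Ioo_right hxR)
    have hfac : ENNReal.ofReal B * ENNReal.ofReal ‖x - x₀‖ ^ ((p - n) / (p - 1))
        ≤ ENNReal.ofReal F := by
      have hx0 : 0 < ‖x - x₀‖ := hd0.trans_le (hKd x hx)
      rw [ENNReal.ofReal_rpow_of_pos hx0, ← ENNReal.ofReal_mul hB.le]
      refine ENNReal.ofReal_le_ofReal (mul_le_mul_of_nonneg_left ?_ hB.le)
      exact Real.rpow_le_rpow_of_nonpos hd0 (hKd x hx)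
        (div_nonpos_of_nonpos_of_nonneg (by linarith) hp1.le)
    set Y := c * (1 + ε ^ q / s * Real.log N) + c * D with hY
    have hY0 : 0 ≤ Y := by positivity
    have hexpY : eexp (ENNReal.ofReal c * wolffT n 1 p σ ‖x - x₀‖ x
        + ENNReal.ofReal c * rieszT n 1 p σ ‖x - x₀‖ x₀) ≤ ENNReal.ofReal (Real.exp Y) := by
      refine eexp_le_ofReal_exp hY0 ?_
      rw [hY, ENNReal.ofReal_add (by positivity) (by positivity), ENNReal.ofReal_mul hc.le,
        ENNReal.ofReal_mul hc.le]
      gcongr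
    calc vp n p B c σ x₀ x ^ p
        ≤ (ENNReal.ofReal F * ENNReal.ofReal (Real.exp Y)) ^ p :=
          ENNReal.rpow_le_rpow (mul_le_mul' hfac hexpY) hp0.le
      _ = ENNReal.ofReal (F ^ p * Real.exp (p * Y)) := by
          rw [← ENNReal.ofReal_mul hF0.le, ENNReal.ofReal_rpow_of_nonneg (by positivity) hp0.le,
            Real.mul_rpow hF0.le (Real.exp_pos _).le, ← Real.exp_mul, mul_comm Y p]
      _ ≤ ENNReal.ofReal (F ^ p * Real.exp (p * (c + c * D)) * N) := by
          refine ENNReal.ofReal_le_ofReal ?_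
          rw [mul_assoc]
          refine mul_le_mul_of_nonneg_left ?_ (by positivity)
          rw [← Real.exp_log hN0, ← Real.exp_add, Real.exp_le_exp]
          have := mul_le_mul_of_nonneg_right hexp hlogN
          rw [hY]
          linarith
      _ = L * ENNReal.ofReal N := ENNReal.ofReal_mul (by positivity)
      _ ≤ L * (1 + M x) := by
          refine mul_le_mul_right ?_ _
          rw [hN, ENNReal.ofReal_max, ENNReal.ofReal_one, ENNReal.ofReal_toReal hMx]
          exact max_le le_self_add le_add_self
  calc ∫⁻ x in K, vp n p B c σ x₀ x ^ p
      ≤ ∫⁻ x in K, L * (1 + M x) := setLIntegral_mono' hK.measurableSet hpt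
    _ = L * (volume K + ∫⁻ x in K, M x) := by
        rw [lintegral_const_mul' _ _ ENNReal.ofReal_ne_top, lintegral_add_left measurable_const,
          setLIntegral_one]
    _ < ∞ := ENNReal.mul_lt_top ENNReal.ofReal_lt_top (ENNReal.add_lt_top.2
        ⟨hK.measure_lt_top, (lintegral_mono_set hKR).trans_lt hMint⟩)
end
end

section
/- Let 1 < p < n, x₀ ∈ ℝⁿ, and suppose ∫_0^1 (σ(B(x₀,r))/r^{n−p}) dr/r < ∞. Let C(σ) = sup_E σ(E)/cap_{1,p}(E), the supremum over compact sets E of positive capacity, and assume C(σ) < ∞. Fix constants B, c > 0 and define v(x) = B·|x−x₀|^{(p−n)/(p−1)} · exp( c ∫_0^{|x−x₀|} (σ(B(x,r))/r^{n−p})^{1/(p−1)} dr/r + c ∫_0^{|x−x₀|} (σ(B(x₀,r))/r^{n−p}) dr/r ). Then there exists a constant C₀ > 0, depending only on n, p and c, such that if C(σ) < C₀, then v ∈ L^p_loc(ℝⁿ \ {x₀}, dσ); that is, ∫_K v^p dσ < ∞ for every compact set K ⊂ ℝⁿ \ {x₀}. -/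
open MeasureTheory Metric Set Filter
open scoped ENNReal NNReal Topology

noncomputable section

/-- The index of the dyadic cube of side `2⁻ᵏ` containing `x`. -/
def cubeIdx {n : ℕ} (k : ℕ) (x : En n) : Fin n → ℤ := fun i => ⌊(2:ℝ) ^ k * x i⌋

/-- The dyadic cube of side `2⁻ᵏ` with index `z`. -/
def cube {n : ℕ} (k : ℕ) (z : Fin n → ℤ) : Set (En n) := {x | cubeIdx k x = z}

/-- The union of the dyadic cube with index `z` and its neighbours of the same generation. -/
def cubeNbhd {n : ℕ} (k : ℕ) (z : Fin n → ℤ) : Set (En n) := {y | ∀ i, |cubeIdx k y i - z i| ≤ 1}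

lemma measurable_cubeIdx {n : ℕ} (k : ℕ) : Measurable (cubeIdx (n := n) k) := by
  refine measurable_pi_iff.2 fun i => Int.measurable_floor.comp ?_
  fun_prop

lemma measurableSet_cube {n : ℕ} (k : ℕ) (z : Fin n → ℤ) : MeasurableSet (cube k z) :=
  measurable_cubeIdx k (measurableSet_singleton z)

lemma measurableSet_cubeNbhd {n : ℕ} (k : ℕ) (z : Fin n → ℤ) : MeasurableSet (cubeNbhd k z) :=
  measurable_cubeIdx k (t := {w | ∀ i, |w i - z i| ≤ 1}) (MeasurableSet.of_discrete)

lemma cube_subset_cubeNbhd {n : ℕ} (k : ℕ) (z : Fin n → ℤ) : cube k z ⊆ cubeNbhd k z := by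
  intro x hx i
  rw [show cubeIdx k x = z from hx]
  simp

/-- The index of the ancestor `i` generations up. -/
def ancestor {n : ℕ} (i : ℕ) (w : Fin n → ℤ) : Fin n → ℤ := fun l => w l / 2 ^ i

lemma cubeIdx_eq_ancestor {n : ℕ} (k i : ℕ) (x : En n) :
    cubeIdx k x = ancestor i (cubeIdx (k + i) x) := by
  funext l
  have h := Int.floor_div_natCast ((2:ℝ) ^ (k + i) * x l) (2 ^ i)
  simp only [cubeIdx, ancestor]
  push_cast at h
  rw [← h, pow_add]
  congr 1
  field_simp

lemma cubeNbhd_subset {n : ℕ} (k i : ℕ) (w : Fin n → ℤ) :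
    cubeNbhd (k + i) w ⊆ cubeNbhd k (ancestor i w) := by
  have key : ∀ a b : ℤ, a ≤ b + 1 → a / 2 ^ i ≤ b / 2 ^ i + 1 := by
    intro a b h
    have hd : (1:ℤ) ≤ 2 ^ i := one_le_pow₀ (by norm_num)
    calc a / 2 ^ i ≤ (b + 1 * 2 ^ i) / 2 ^ i := Int.ediv_le_ediv (by positivity) (by linarith)
      _ = b / 2 ^ i + 1 := Int.add_mul_ediv_right _ _ (by positivity)
  intro y hy l
  rw [cubeIdx_eq_ancestor k i]
  have h := abs_le.1 (hy l)
  have h1 := key _ _ (show cubeIdx (k + i) y l ≤ w l + 1 by linarith [h.2])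
  have h2 := key _ _ (show w l ≤ cubeIdx (k + i) y l + 1 by linarith [h.1])
  simp only [ancestor]
  exact abs_le.2 ⟨by linarith, by linarith⟩

lemma norm_sub_le_of_mem_cubeNbhd {n : ℕ} {k : ℕ} {x y : En n}
    (h : x ∈ cubeNbhd k (cubeIdx k y)) : 2 ^ k * ‖x - y‖ ≤ 2 * √n := by
  have hc : ∀ i, ‖(x - y) i‖ ^ 2 ≤ (2 / 2 ^ k) ^ 2 := by
    intro i
    have h1 := h i
    rw [← Int.cast_le (R := ℝ)] at h1
    simp only [cubeIdx] at h1
    push_cast at h1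
    rw [abs_le] at h1
    have a1 := Int.floor_le ((2:ℝ) ^ k * x i)
    have a2 := Int.lt_floor_add_one ((2:ℝ) ^ k * x i)
    have b1 := Int.floor_le ((2:ℝ) ^ k * y i)
    have b2 := Int.lt_floor_add_one ((2:ℝ) ^ k * y i)
    have h2 : |x i - y i| ≤ 2 / 2 ^ k := by
      rw [le_div_iff₀ (by positivity), ← abs_of_pos (show (0:ℝ) < 2 ^ k by positivity), ← abs_mul,
        abs_le]
      constructor <;> rw [sub_mul] <;> linarith
    simp only [PiLp.sub_apply, Real.norm_eq_abs]
    gcongr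
  have h3 : ‖x - y‖ ≤ √n * (2 / 2 ^ k) := by
    rw [EuclideanSpace.norm_eq]
    apply Real.sqrt_le_iff.2 ⟨by positivity, ?_⟩
    calc ∑ i, ‖(x - y) i‖ ^ 2 ≤ ∑ _i : Fin n, ((2:ℝ) / 2 ^ k) ^ 2 :=
          Finset.sum_le_sum fun i _ => hc i
      _ = (√n * (2 / 2 ^ k)) ^ 2 := by
          rw [mul_pow, Real.sq_sqrt (by positivity)]; simp
  calc 2 ^ k * ‖x - y‖ ≤ 2 ^ k * (√n * (2 / 2 ^ k)) := by gcongr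
    _ = 2 * √n := by field_simp

lemma ball_subset_cubeNbhd {n : ℕ} {k : ℕ} {x : En n} {r : ℝ} (hr : r ≤ (2 ^ k)⁻¹) :
    ball x r ⊆ cubeNbhd k (cubeIdx k x) := by
  intro y hy i
  have h1 : |y i - x i| < (2 ^ k)⁻¹ := by
    have := PiLp.norm_apply_le (y - x) i
    rw [mem_ball, dist_eq_norm] at hy
    simp only [PiLp.sub_apply, Real.norm_eq_abs] at this
    linarith
  have h2 : |2 ^ k * y i - 2 ^ k * x i| < 1 := by
    rw [← mul_sub, abs_mul, abs_of_pos (by positivity)]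
    calc 2 ^ k * |y i - x i| < 2 ^ k * (2 ^ k)⁻¹ := by gcongr
      _ = 1 := by field_simp
  rw [abs_lt] at h2
  have a1 := Int.floor_le ((2:ℝ) ^ k * x i)
  have a2 := Int.lt_floor_add_one ((2:ℝ) ^ k * x i)
  have b1 := Int.floor_le ((2:ℝ) ^ k * y i)
  have b2 := Int.lt_floor_add_one ((2:ℝ) ^ k * y i)
  have c1 : ⌊(2:ℝ) ^ k * y i⌋ < ⌊(2:ℝ) ^ k * x i⌋ + 2 := by
    rw [← Int.cast_lt (R := ℝ)]; push_cast; linarith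
  have c2 : ⌊(2:ℝ) ^ k * x i⌋ < ⌊(2:ℝ) ^ k * y i⌋ + 2 := by
    rw [← Int.cast_lt (R := ℝ)]; push_cast; linarith
  simp only [cubeIdx]
  exact abs_le.2 ⟨by omega, by omega⟩

lemma isBounded_cubeNbhd {n : ℕ} (k : ℕ) (z : Fin n → ℤ) :
    Bornology.IsBounded (cubeNbhd k z) := by
  refine (isBounded_iff_forall_norm_le).2 ⟨√n * ∑ i, (|(z i : ℝ)| + 2), fun y hy => ?_⟩
  have hc : ∀ i, ‖y i‖ ≤ ∑ i, (|(z i : ℝ)| + 2) := by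
    intro i
    refine le_trans ?_ (Finset.single_le_sum (f := fun i => |(z i : ℝ)| + 2)
      (fun i _ => by positivity) (Finset.mem_univ i))
    have h1 := hy i
    rw [← Int.cast_le (R := ℝ)] at h1
    simp only [cubeIdx] at h1
    push_cast at h1
    rw [abs_le] at h1
    have a1 := Int.floor_le ((2:ℝ) ^ k * y i)
    have a2 := Int.lt_floor_add_one ((2:ℝ) ^ k * y i)
    have h2 : |2 ^ k * y i| ≤ |(z i : ℝ)| + 2 := by
      rw [abs_le]
      constructor <;> linarith [neg_abs_le (z i : ℝ), le_abs_self (z i : ℝ)]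
    rw [abs_mul, abs_of_pos (show (0:ℝ) < 2 ^ k by positivity)] at h2
    have h3 : (1:ℝ) ≤ 2 ^ k := one_le_pow₀ (by norm_num)
    rw [Real.norm_eq_abs]
    nlinarith [abs_nonneg (y i)]
  rw [EuclideanSpace.norm_eq]
  have h0 : 0 ≤ ∑ i, (|(z i : ℝ)| + 2) := Finset.sum_nonneg fun i _ => by positivity
  apply Real.sqrt_le_iff.2 ⟨by positivity, ?_⟩
  calc ∑ i, ‖y i‖ ^ 2 ≤ ∑ _i : Fin n, (∑ i, (|(z i : ℝ)| + 2)) ^ 2 :=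
        Finset.sum_le_sum fun i _ => by gcongr; exact hc i
    _ = (√n * ∑ i, (|(z i : ℝ)| + 2)) ^ 2 := by
        rw [mul_pow, Real.sq_sqrt (by positivity)]; simp

lemma volume_cube {n : ℕ} (k : ℕ) (z : Fin n → ℤ) :
    volume (cube k z) = ((2:ℝ≥0∞) ^ (k * n))⁻¹ := by
  have h := (PiLp.volume_preserving_ofLp (Fin n)).measure_preimage
    (s := Set.pi univ fun i => Ico ((z i : ℝ) / 2 ^ k) ((z i + 1) / 2 ^ k))
    (MeasurableSet.univ_pi fun i => measurableSet_Ico).nullMeasurableSet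
  have h2 : cube k z = (WithLp.ofLp : En n → (Fin n → ℝ)) ⁻¹'
      (Set.pi univ fun i => Ico ((z i : ℝ) / 2 ^ k) ((z i + 1) / 2 ^ k)) := by
    ext x
    simp only [cube, cubeIdx, funext_iff, mem_ofPred_eq, mem_preimage, Set.mem_pi, mem_univ,
      true_imp_iff, mem_Ico, Int.floor_eq_iff]
    refine forall_congr' fun i => ?_
    rw [div_le_iff₀ (by positivity), lt_div_iff₀ (by positivity), mul_comm (x i)]
  rw [h2, h, Real.volume_pi_Ico]
  have h3 : ∀ i, ((z i + 1 : ℝ)) / 2 ^ k - z i / 2 ^ k = (2 ^ k)⁻¹ := fun i => by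
    field_simp; ring
  simp only [h3, Finset.prod_const, Finset.card_univ, Fintype.card_fin]
  rw [ENNReal.ofReal_inv_of_pos (by positivity), ENNReal.ofReal_pow (by norm_num),
    ← ENNReal.inv_pow, pow_mul]
  simp

lemma rieszPot_one_eq {n : ℕ} (hn : 2 ≤ n) (f : En n → ℝ≥0∞) (x : En n) :
    rieszPot n 1 f x = ENNReal.ofReal (((n:ℝ) - 1)⁻¹)
      * ∫⁻ y, f y * (ENNReal.ofReal ‖x - y‖ ^ (n - 1))⁻¹ := by
  have : Nonempty (Fin n) := ⟨⟨0, by omega⟩⟩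
  unfold rieszPot
  congr 1
  apply lintegral_congr_ae
  have h0 : ∀ᵐ y : En n, y ≠ x := by
    rw [ae_iff]
    simp
  filter_upwards [h0] with y hy
  have hpos : 0 < ‖x - y‖ := norm_pos_iff.2 (sub_ne_zero.2 hy.symm)
  congr 1
  rw [← ENNReal.ofReal_pow hpos.le, ← ENNReal.ofReal_inv_of_pos (by positivity)]
  congr 1
  rw [show (1 - (n:ℝ)) = -((n - 1 : ℕ) : ℝ) by push_cast [show 1 ≤ n by omega]; ring,
    Real.rpow_neg hpos.le, Real.rpow_natCast]

lemma measurable_rieszPot {n : ℕ} (hn : 2 ≤ n) {f : En n → ℝ≥0∞} (hf : Measurable f) :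
    Measurable (rieszPot n 1 f) := by
  rw [funext (rieszPot_one_eq hn f)]
  refine Measurable.const_mul ?_ _
  refine Measurable.lintegral_prod_right'
    (f := fun q : En n × En n => f q.2 * (ENNReal.ofReal ‖q.1 - q.2‖ ^ (n - 1))⁻¹) ?_
  fun_prop

/-- `∑ 2^{jm}` over the generations `j` with `2ʲ d ≤ L` is controlled by `(L/d)ᵐ`. -/
lemma sum_pow_ite_le {m : ℕ} (hm : 1 ≤ m) {d L : ℝ} (hd : 0 < d) (hL : 0 ≤ L) (k N : ℕ) :
    ∑ i ∈ Finset.range N, (if 2 ^ (k + i) * d ≤ L then (2:ℝ) ^ ((k + i) * m) else 0)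
      ≤ 2 * (L / d) ^ m := by
  have hgeo : ∀ N : ℕ, ∑ i ∈ Finset.range (N + 1), (2:ℝ) ^ ((k + i) * m)
      ≤ 2 * 2 ^ ((k + N) * m) := by
    intro N
    induction N with
    | zero => simp
    | succ N ih =>
      rw [Finset.sum_range_succ]
      have h1 : (2:ℝ) * 2 ^ ((k + N) * m) ≤ 2 ^ ((k + (N + 1)) * m) := by
        rw [← pow_succ']
        apply pow_le_pow_right₀ (by norm_num)
        nlinarith
      linarith
  induction N with
  | zero => simp; positivity
  | succ N ih =>
    by_cases h : 2 ^ (k + N) * d ≤ L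
    · calc _ ≤ ∑ i ∈ Finset.range (N + 1), (2:ℝ) ^ ((k + i) * m) := by
            gcongr with i
            split_ifs
            · exact le_rfl
            · positivity
        _ ≤ 2 * 2 ^ ((k + N) * m) := hgeo N
        _ ≤ 2 * (L / d) ^ m := by
            rw [pow_mul]
            gcongr
            rwa [le_div_iff₀ hd]
    · rw [Finset.sum_range_succ, if_neg h, add_zero]
      exact ih

lemma sum_indicator_cubeNbhd_le {n : ℕ} (hn : 2 ≤ n) (k N : ℕ) (x y : En n) :
    ∑ i ∈ Finset.range N, (2:ℝ≥0∞) ^ ((k + i) * (n - 1))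
        * (cubeNbhd (k + i) (cubeIdx (k + i) y)).indicator 1 x
      ≤ ENNReal.ofReal (2 * (2 * √n) ^ (n - 1)) * (ENNReal.ofReal ‖x - y‖ ^ (n - 1))⁻¹ := by
  rcases eq_or_ne x y with rfl | hxy
  · have h1 : ENNReal.ofReal (2 * (2 * √n) ^ (n - 1)) ≠ 0 := by
      have : 0 < n := by omega
      rw [Ne, ENNReal.ofReal_eq_zero, not_le]
      positivity
    have h2 : n - 1 ≠ 0 := by omega
    rw [sub_self, norm_zero, ENNReal.ofReal_zero, zero_pow h2, ENNReal.inv_zero, ENNReal.mul_top h1]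
    exact le_top
  · have hd : 0 < ‖x - y‖ := norm_pos_iff.2 (sub_ne_zero.2 hxy)
    have h := sum_pow_ite_le (m := n - 1) (by omega) hd (show 0 ≤ 2 * √n by positivity) k N
    have h' := ENNReal.ofReal_le_ofReal h
    rw [ENNReal.ofReal_sum_of_nonneg (fun i _ => by split_ifs <;> positivity)] at h'
    refine le_trans (Finset.sum_le_sum fun i _ => ?_) (h'.trans_eq ?_)
    · by_cases hx : x ∈ cubeNbhd (k + i) (cubeIdx (k + i) y)
      · rw [if_pos (norm_sub_le_of_mem_cubeNbhd hx), indicator_of_mem hx,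
          ENNReal.ofReal_pow (by norm_num)]
        simp
      · simp [indicator_of_notMem hx]
    · rw [← ENNReal.ofReal_pow hd.le, ← ENNReal.ofReal_inv_of_pos (by positivity),
        ← ENNReal.ofReal_mul (by positivity)]
      congr 1
      rw [div_pow]
      ring

/-- The capacitary condition gives a weak-type trace inequality. -/
lemma measure_le_rieszPot_le {n : ℕ} (hn : 2 ≤ n) {p : ℝ} (hp : 1 < p) {σ : Measure (En n)}
    [IsLocallyFiniteMeasure σ] {C : ℝ≥0∞}
    (hσ : ∀ E : Set (En n), IsCompact E → σ E ≤ C * rieszCap n 1 p E)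
    {f : En n → ℝ≥0∞} (hf : Measurable f) {t : ℝ≥0∞} (ht0 : t ≠ 0) (ht : t ≠ ∞) :
    σ {x | t ≤ rieszPot n 1 f x} ≤ C * (t ^ (-p) * ∫⁻ y, f y ^ p) := by
  rw [(measurableSet_le measurable_const (measurable_rieszPot hn hf)).measure_eq_iSup_isCompact]
  refine iSup_le fun E => iSup_le fun hE => iSup_le fun hEc => (hσ E hEc).trans ?_
  gcongr
  refine (iInf₂_le (fun y => t⁻¹ * f y) (hf.const_mul _)).trans ((iInf_le _ ?_).trans_eq ?_)
  · intro x hx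
    have h1 : rieszPot n 1 (fun y => t⁻¹ * f y) x = t⁻¹ * rieszPot n 1 f x := by
      rw [rieszPot_one_eq hn, rieszPot_one_eq hn, mul_left_comm,
        ← lintegral_const_mul t⁻¹ (by fun_prop)]
      simp only [mul_assoc]
    rw [h1]
    calc 1 = t⁻¹ * t := (ENNReal.inv_mul_cancel ht0 ht).symm
      _ ≤ _ := by gcongr; exact hE hx
  · rw [← lintegral_const_mul _ (by fun_prop)]
    refine lintegral_congr fun y => ?_
    rw [ENNReal.mul_rpow_of_nonneg _ _ (by linarith), ENNReal.inv_rpow, ENNReal.rpow_neg]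

/-- A dyadic layer-cake bound. -/
lemma setLIntegral_le_dyadic {α : Type*} [MeasurableSpace α] {μ : Measure α} {u : α → ℝ≥0∞}
    (hu : Measurable u) {t : ℝ≥0∞} (ht0 : t ≠ 0) (F : Set α) :
    ∫⁻ x in F, u x ∂μ ≤ t * μ F + ∑' i : ℕ, 2 ^ (i + 1) * t * μ {x | 2 ^ i * t ≤ u x} := by
  have hms : ∀ i : ℕ, MeasurableSet {x | 2 ^ i * t ≤ u x} := fun i =>
    measurableSet_le measurable_const hu
  have hpt : ∀ x, u x ≤ t + ∑' i : ℕ, 2 ^ (i + 1) * t * {x | 2 ^ i * t ≤ u x}.indicator 1 x := by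
    intro x
    by_cases h : ∃ N : ℕ, u x < 2 ^ N * t
    · obtain ⟨N, hN⟩ := h
      induction N with
      | zero => exact le_add_right (by simpa using hN.le)
      | succ N ih =>
        by_cases h : u x < 2 ^ N * t
        · exact ih h
        · have hmem : x ∈ {x | 2 ^ N * t ≤ u x} := not_lt.1 h
          refine le_add_left (le_trans ?_ (ENNReal.le_tsum N))
          rw [indicator_of_mem hmem]
          simpa using hN.le
    · push Not at h
      refine le_add_left (le_top.trans_eq (Eq.symm (top_le_iff.1 ?_)))
      rw [← ENNReal.tsum_const_eq_top_of_ne_zero (α := ℕ) ht0]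
      refine ENNReal.tsum_le_tsum fun i => ?_
      rw [indicator_of_mem (show x ∈ {x | 2 ^ i * t ≤ u x} from h i)]
      simp only [Pi.one_apply, mul_one]
      exact le_mul_of_one_le_left' (one_le_pow₀ (by norm_num))
  calc ∫⁻ x in F, u x ∂μ
      ≤ ∫⁻ x in F, (t + ∑' i : ℕ, 2 ^ (i + 1) * t * {x | 2 ^ i * t ≤ u x}.indicator 1 x) ∂μ :=
        lintegral_mono hpt
    _ = t * μ F + ∑' i : ℕ, ∫⁻ x in F, 2 ^ (i + 1) * t * {x | 2 ^ i * t ≤ u x}.indicator 1 x ∂μ := by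
        rw [lintegral_add_left measurable_const, setLIntegral_const, lintegral_tsum]
        exact fun i => ((measurable_one.indicator (hms i)).const_mul _).aemeasurable
    _ ≤ _ := by
        gcongr with i
        rw [lintegral_const_mul _ (measurable_one.indicator (hms i)), lintegral_indicator_one (hms i)]
        gcongr
        exact Measure.restrict_le_self

lemma setLIntegral_rieszPot_le {n : ℕ} (hn : 2 ≤ n) {p : ℝ} (hp : 1 < p) {σ : Measure (En n)}
    [IsLocallyFiniteMeasure σ] {C : ℝ≥0∞}
    (hσ : ∀ E : Set (En n), IsCompact E → σ E ≤ C * rieszCap n 1 p E)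
    {f : En n → ℝ≥0∞} (hf : Measurable f) {t : ℝ≥0∞} (ht0 : t ≠ 0) (ht : t ≠ ∞)
    (F : Set (En n)) :
    ∫⁻ x in F, rieszPot n 1 f x ∂σ
      ≤ t * σ F + 2 * (1 - 2 ^ (1 - p))⁻¹ * t ^ (1 - p) * C * ∫⁻ y, f y ^ p := by
  refine (setLIntegral_le_dyadic (measurable_rieszPot hn hf) ht0 F).trans ?_
  gcongr
  calc ∑' i : ℕ, 2 ^ (i + 1) * t * σ {x | 2 ^ i * t ≤ rieszPot n 1 f x}
      ≤ ∑' i : ℕ, 2 ^ (i + 1) * t * (C * ((2 ^ i * t) ^ (-p) * ∫⁻ y, f y ^ p)) := by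
        gcongr with i
        exact measure_le_rieszPot_le hn hp hσ hf (mul_ne_zero (by positivity) ht0)
          (ENNReal.mul_ne_top (by simp) ht)
    _ = ∑' i : ℕ, (2 * t ^ (1 - p) * C * ∫⁻ y, f y ^ p) * (2 ^ (1 - p)) ^ i := by
        refine tsum_congr fun i => ?_
        have h1 : t ^ (1 - p) = t * t ^ (-p) := by
          rw [sub_eq_add_neg, ENNReal.rpow_add _ _ ht0 ht, ENNReal.rpow_one]
        have h2 : ((2:ℝ≥0∞) ^ (1 - p)) ^ i = 2 ^ i * (2 ^ i) ^ (-p) := by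
          rw [sub_eq_add_neg, ENNReal.rpow_add _ _ (by simp) (by simp), ENNReal.rpow_one, mul_pow,
            ← ENNReal.rpow_mul_natCast, ← ENNReal.rpow_natCast_mul, mul_comm (-p)]
        rw [h1, h2, ENNReal.mul_rpow_of_ne_top (by simp) ht, pow_succ]
        ring
    _ = _ := by
        rw [ENNReal.tsum_mul_left, ENNReal.tsum_geometric]
        ring

/-- The normalised mass `2^{k(n-1)} σ(Q*)` of the neighbourhood of a dyadic cube. -/
def dens {n : ℕ} (σ : Measure (En n)) (k : ℕ) (z : Fin n → ℤ) : ℝ≥0∞ :=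
  2 ^ (k * (n - 1)) * σ (cubeNbhd k z)

lemma measurable_dens {n : ℕ} (σ : Measure (En n)) (k : ℕ) :
    Measurable fun y : En n => dens σ k (cubeIdx k y) :=
  (measurable_of_countable (dens σ k)).comp (measurable_cubeIdx k)

lemma sum_dens_le {n : ℕ} (hn : 2 ≤ n) (σ : Measure (En n)) [SFinite σ] (k N : ℕ)
    {z : Fin n → ℤ} {y : En n} (hy : y ∈ cube k z) :
    ∑ i ∈ Finset.range N, dens σ (k + i) (cubeIdx (k + i) y)
      ≤ ENNReal.ofReal (2 * (2 * √n) ^ (n - 1))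
        * ∫⁻ x in cubeNbhd k z, (ENNReal.ofReal ‖x - y‖ ^ (n - 1))⁻¹ ∂σ := by
  have hsub : ∀ i, cubeNbhd (k + i) (cubeIdx (k + i) y) ⊆ cubeNbhd k z := fun i => by
    rw [← show cubeIdx k y = z from hy, cubeIdx_eq_ancestor k i]
    exact cubeNbhd_subset k i _
  have hm : ∀ i, MeasurableSet (cubeNbhd (k + i) (cubeIdx (k + i) y)) := fun i =>
    measurableSet_cubeNbhd _ _
  calc ∑ i ∈ Finset.range N, dens σ (k + i) (cubeIdx (k + i) y)
      = ∑ i ∈ Finset.range N, ∫⁻ x in cubeNbhd k z, (2:ℝ≥0∞) ^ ((k + i) * (n - 1))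
          * (cubeNbhd (k + i) (cubeIdx (k + i) y)).indicator 1 x ∂σ := by
        refine Finset.sum_congr rfl fun i _ => ?_
        rw [lintegral_const_mul _ (measurable_one.indicator (hm i)),
          lintegral_indicator_one (hm i), Measure.restrict_apply (hm i),
          inter_eq_self_of_subset_left (hsub i), dens]
    _ = ∫⁻ x in cubeNbhd k z, ∑ i ∈ Finset.range N, (2:ℝ≥0∞) ^ ((k + i) * (n - 1))
          * (cubeNbhd (k + i) (cubeIdx (k + i) y)).indicator 1 x ∂σ :=
        (lintegral_finsetSum _ fun i _ => (measurable_one.indicator (hm i)).const_mul _).symm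
    _ ≤ ∫⁻ x in cubeNbhd k z, ENNReal.ofReal (2 * (2 * √n) ^ (n - 1))
          * (ENNReal.ofReal ‖x - y‖ ^ (n - 1))⁻¹ ∂σ :=
        lintegral_mono fun x => sum_indicator_cubeNbhd_le hn k N x y
    _ = _ := lintegral_const_mul _ (by fun_prop)

lemma le_two_mul_of_le_add_half {X a : ℝ≥0∞} (hX : X ≠ ∞) (h : X ≤ a + X / 2) : X ≤ 2 * a := by
  have h1 : X / 2 ≠ ∞ := (ENNReal.half_le_self.trans_lt hX.lt_top).ne
  have h2 : X / 2 ≤ a := by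
    refine (ENNReal.add_le_add_iff_right h1).1 ?_
    rwa [ENNReal.add_halves]
  calc X = X / 2 + X / 2 := (ENNReal.add_halves X).symm
    _ ≤ a + a := by gcongr
    _ = 2 * a := (two_mul a).symm

/-- The constant comparing dyadic sums with the Riesz potential of order one. -/
def rieszConst (n : ℕ) : ℝ≥0∞ :=
  ENNReal.ofReal (2 * (2 * √n) ^ (n - 1)) * ENNReal.ofReal ((n:ℝ) - 1)

/-- The testing (Carleson) condition derived from the capacitary condition by duality. -/
lemma sum_setLIntegral_dens_le {n : ℕ} (hn : 2 ≤ n) {p : ℝ} (hp : 1 < p) {σ : Measure (En n)}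
    [IsLocallyFiniteMeasure σ] {C : ℝ≥0∞}
    (hσ : ∀ E : Set (En n), IsCompact E → σ E ≤ C * rieszCap n 1 p E)
    {t : ℝ≥0∞} (ht0 : t ≠ 0) (ht : t ≠ ∞)
    (htC : rieszConst n * (2 * (1 - 2 ^ (1 - p))⁻¹ * t ^ (1 - p) * C) ≤ 2⁻¹)
    (k N : ℕ) (z : Fin n → ℤ) :
    ∑ i ∈ Finset.range N, ∫⁻ y in cube k z,
        dens σ (k + i) (cubeIdx (k + i) y) ^ (1 / (p - 1)) * dens σ (k + i) (cubeIdx (k + i) y)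
      ≤ 2 * (rieszConst n * t) * σ (cubeNbhd k z) := by
  set s : ℝ := 1 / (p - 1) with hs
  have hp1 : 0 < p - 1 := by linarith
  have hs0 : 0 < s := by positivity
  set F := cubeNbhd k z with hF
  set G : En n → ℝ≥0∞ := fun y => ∑ i ∈ Finset.range N, dens σ (k + i) (cubeIdx (k + i) y) with hG
  have hGm : Measurable G := Finset.measurable_fun_sum _ fun i _ => measurable_dens σ (k + i)
  have hQ := measurableSet_cube k z
  set f : En n → ℝ≥0∞ := (cube k z).indicator fun y => G y ^ s with hf
  have hfm : Measurable f := (hGm.pow_const s).indicator hQ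
  set X := ∫⁻ y in cube k z, G y ^ s * G y with hXdef
  have hFfin : σ F ≠ ∞ := (isBounded_cubeNbhd k z).measure_lt_top.ne
  have hXfin : X ≠ ∞ := by
    set M : ℝ≥0∞ := ∑ i ∈ Finset.range N, 2 ^ ((k + i) * (n - 1)) * σ F
    have hM : M ≠ ∞ := ENNReal.sum_ne_top.2 fun i _ => ENNReal.mul_ne_top (by simp) hFfin
    have hle : X ≤ ∫⁻ _y in cube k z, M ^ s * M := by
      refine setLIntegral_mono measurable_const fun y hy => ?_
      have : G y ≤ M := by
        refine Finset.sum_le_sum fun i _ => ?_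
        rw [dens]
        gcongr
        rw [hF, ← show cubeIdx k y = z from hy, cubeIdx_eq_ancestor k i]
        exact cubeNbhd_subset k i _
      gcongr
    refine (hle.trans_lt ?_).ne
    rw [setLIntegral_const, volume_cube]
    refine ENNReal.mul_lt_top (ENNReal.mul_lt_top ?_ hM.lt_top) (ENNReal.inv_lt_top.2 (by positivity))
    exact ENNReal.rpow_lt_top_of_nonneg hs0.le hM
  have hfp : ∫⁻ y, f y ^ p = X := by
    rw [hXdef, ← lintegral_indicator hQ]
    refine lintegral_congr fun y => ?_
    by_cases hy : y ∈ cube k z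
    · rw [hf, indicator_of_mem hy, indicator_of_mem hy, ← ENNReal.rpow_mul]
      have h1 : s * p = s + 1 := by rw [hs]; field_simp; ring
      rw [h1, ENNReal.rpow_add_of_nonneg _ _ hs0.le zero_le_one, ENNReal.rpow_one]
    · rw [hf, indicator_of_notMem hy, indicator_of_notMem hy, ENNReal.zero_rpow_of_pos (by linarith)]
  set c₁ := ENNReal.ofReal (2 * (2 * √n) ^ (n - 1)) with hc₁
  have hn1 : (0:ℝ) < n - 1 := by
    have : (2:ℝ) ≤ n := by exact_mod_cast hn
    linarith
  have hX : X ≤ rieszConst n * ∫⁻ x in F, rieszPot n 1 f x ∂σ := by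
    calc X = ∫⁻ y, f y * G y := by
          rw [hXdef, ← lintegral_indicator hQ]
          refine lintegral_congr fun y => ?_
          by_cases hy : y ∈ cube k z <;> simp [hf, hy]
      _ ≤ ∫⁻ y, c₁ * (∫⁻ x in F, f y * (ENNReal.ofReal ‖x - y‖ ^ (n - 1))⁻¹ ∂σ) := by
          refine lintegral_mono fun y => ?_
          simp only
          rw [lintegral_const_mul _ (by fun_prop), mul_left_comm]
          by_cases hy : y ∈ cube k z
          · gcongr
            exact sum_dens_le hn σ k N hy
          · simp [hf, hy]
      _ = c₁ * ∫⁻ y, ∫⁻ x in F, f y * (ENNReal.ofReal ‖x - y‖ ^ (n - 1))⁻¹ ∂σ := by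
          rw [lintegral_const_mul]
          refine Measurable.lintegral_prod_right'
            (f := fun q : En n × En n => f q.1 * (ENNReal.ofReal ‖q.2 - q.1‖ ^ (n - 1))⁻¹) ?_
          fun_prop
      _ = c₁ * ∫⁻ x in F, (∫⁻ y, f y * (ENNReal.ofReal ‖x - y‖ ^ (n - 1))⁻¹) ∂σ := by
          rw [lintegral_lintegral_swap]
          refine Measurable.aemeasurable ?_
          show Measurable fun q : En n × En n => f q.1 * (ENNReal.ofReal ‖q.2 - q.1‖ ^ (n - 1))⁻¹
          fun_prop
      _ = _ := by
          rw [rieszConst, mul_assoc, ← lintegral_const_mul _ (measurable_rieszPot hn hfm)]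
          congr 1
          refine lintegral_congr fun x => ?_
          rw [rieszPot_one_eq hn, ← mul_assoc, ← ENNReal.ofReal_mul hn1.le,
            mul_inv_cancel₀ hn1.ne', ENNReal.ofReal_one, one_mul]
  have hX2 : X ≤ 2 * (rieszConst n * t * σ F) := by
    refine le_two_mul_of_le_add_half hXfin (hX.trans ?_)
    calc _ ≤ rieszConst n * (t * σ F + 2 * (1 - 2 ^ (1 - p))⁻¹ * t ^ (1 - p) * C * X) := by
          rw [← hfp]
          gcongr
          exact setLIntegral_rieszPot_le hn hp hσ hfm ht0 ht F
      _ = rieszConst n * t * σ F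
          + rieszConst n * (2 * (1 - 2 ^ (1 - p))⁻¹ * t ^ (1 - p) * C) * X := by ring
      _ ≤ rieszConst n * t * σ F + 2⁻¹ * X := by gcongr
      _ = _ := by rw [ENNReal.div_eq_inv_mul]
  calc _ = ∫⁻ y in cube k z, ∑ i ∈ Finset.range N,
        dens σ (k + i) (cubeIdx (k + i) y) ^ s * dens σ (k + i) (cubeIdx (k + i) y) :=
        (lintegral_finsetSum _ fun i _ =>
          ((measurable_dens σ _).pow_const s).mul (measurable_dens σ _)).symm
    _ ≤ X := by
        refine lintegral_mono fun y => ?_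
        simp only [hG]
        rw [Finset.mul_sum]
        refine Finset.sum_le_sum fun i hi => ?_
        gcongr
        exact Finset.single_le_sum (f := fun i => dens σ (k + i) (cubeIdx (k + i) y))
          (fun _ _ => zero_le) hi
    _ ≤ _ := hX2.trans_eq (by ring)

lemma add_pow_succ_le (x y : ℝ≥0∞) (m : ℕ) :
    (x + y) ^ (m + 1) ≤ y ^ (m + 1) + (m + 1) * (x * (x + y) ^ m) := by
  induction m with
  | zero => simp [add_comm]
  | succ m ih =>
    calc (x + y) ^ (m + 1 + 1) = x * (x + y) ^ (m + 1) + y * (x + y) ^ (m + 1) := by ring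
      _ ≤ x * (x + y) ^ (m + 1) + y * (y ^ (m + 1) + (m + 1) * (x * (x + y) ^ m)) := by gcongr
      _ = x * (x + y) ^ (m + 1) + y ^ (m + 1 + 1) + (m + 1) * (x * ((x + y) ^ m * y)) := by ring
      _ ≤ x * (x + y) ^ (m + 1) + y ^ (m + 1 + 1) + (m + 1) * (x * ((x + y) ^ m * (x + y))) := by
          gcongr
          exact le_add_self
      _ = _ := by push_cast; ring

lemma sum_pow_succ_le (m N : ℕ) (a : ℕ → ℝ≥0∞) :
    (∑ i ∈ Finset.range N, a i) ^ (m + 1)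
      ≤ (m + 1) * ∑ i ∈ Finset.range N, a i * (∑' j, a (i + j)) ^ m := by
  induction N generalizing a with
  | zero => simp
  | succ N ih =>
    rw [Finset.sum_range_succ', Finset.sum_range_succ', add_comm (∑ i ∈ Finset.range N, a (i + 1))]
    refine (add_pow_succ_le _ _ m).trans ?_
    rw [mul_add]
    gcongr
    · refine (ih fun i => a (i + 1)).trans_eq ?_
      simp only [add_right_comm]
    · have := ENNReal.sum_le_tsum (f := a) (Finset.range (N + 1))
      rw [Finset.sum_range_succ', add_comm] at this
      simpa using this

lemma tsum_pow_succ_le (m : ℕ) (a : ℕ → ℝ≥0∞) :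
    (∑' i, a i) ^ (m + 1) ≤ (m + 1) * ∑' i, a i * (∑' j, a (i + j)) ^ m := by
  refine le_of_tendsto' (ENNReal.Tendsto.pow (n := m + 1) (ENNReal.tendsto_nat_tsum a)) fun N => ?_
  refine (sum_pow_succ_le m N a).trans ?_
  gcongr
  exact ENNReal.sum_le_tsum _

lemma lintegral_cubeIdx_mul {n : ℕ} {μ : Measure (En n)} {F : En n → ℝ≥0∞} (hF : Measurable F)
    (k : ℕ) (Φ : (Fin n → ℤ) → ℝ≥0∞) :
    ∫⁻ x, Φ (cubeIdx k x) * F x ∂μ = ∑' w, Φ w * ∫⁻ x in cube k w, F x ∂μ := by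
  have hΦ : Measurable Φ := measurable_of_countable Φ
  have h1 : ∫⁻ x, Φ (cubeIdx k x) * F x ∂μ = ∫⁻ x, Φ (cubeIdx k x) ∂(μ.withDensity F) := by
    refine Eq.trans ?_
      (lintegral_withDensity_eq_lintegral_mul _ hF (hΦ.comp (measurable_cubeIdx k))).symm
    simp only [Pi.mul_apply, Function.comp_apply, mul_comm]
  rw [h1, ← lintegral_map hΦ (measurable_cubeIdx k), lintegral_countable']
  refine tsum_congr fun w => ?_
  rw [Measure.map_apply (measurable_cubeIdx k) (measurableSet_singleton w),
    withDensity_apply _ (measurable_cubeIdx k (measurableSet_singleton w))]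
  rfl

lemma setLIntegral_cubeIdx_mul_le {n : ℕ} {μ ν : Measure (En n)} {F G : En n → ℝ≥0∞}
    (hF : Measurable F) (hG : Measurable G) {k i : ℕ}
    (h : ∀ w, ∫⁻ x in cube (k + i) w, F x ∂μ ≤ ∫⁻ x in cube (k + i) w, G x ∂ν)
    (Φ : (Fin n → ℤ) → ℝ≥0∞) (z : Fin n → ℤ) :
    ∫⁻ x in cube k z, Φ (cubeIdx (k + i) x) * F x ∂μ
      ≤ ∫⁻ x in cube k z, Φ (cubeIdx (k + i) x) * G x ∂ν := by
  have key : ∀ (H : En n → ℝ≥0∞) (τ : Measure (En n)), Measurable H →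
      ∫⁻ x in cube k z, Φ (cubeIdx (k + i) x) * H x ∂τ
        = ∑' w, {w | ancestor i w = z}.indicator Φ w * ∫⁻ x in cube (k + i) w, H x ∂τ := by
    intro H τ hH
    rw [← lintegral_cubeIdx_mul hH, ← lintegral_indicator (measurableSet_cube k z)]
    refine lintegral_congr fun x => ?_
    by_cases hx : x ∈ cube k z
    · have h2 : cubeIdx (k + i) x ∈ {w | ancestor i w = z} := by
        rw [mem_ofPred_eq, ← cubeIdx_eq_ancestor]
        exact hx
      rw [indicator_of_mem hx, indicator_of_mem h2]
    · have h2 : cubeIdx (k + i) x ∉ {w | ancestor i w = z} := by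
        rw [mem_ofPred_eq, ← cubeIdx_eq_ancestor]
        exact hx
      rw [indicator_of_notMem hx, indicator_of_notMem h2, zero_mul]
  rw [key F μ hF, key G ν hG]
  exact ENNReal.tsum_le_tsum fun w => mul_le_mul_right (h w) _

/-- The coefficient `(σ(Q*) / ℓ(Q)^{n-p})^{1/(p-1)}` of a dyadic cube. -/
def wolffCoeff {n : ℕ} (p : ℝ) (σ : Measure (En n)) (k : ℕ) (z : Fin n → ℤ) : ℝ≥0∞ :=
  dens σ k z ^ (1 / (p - 1)) * (2 ^ k)⁻¹

/-- The dyadic Wolff potential over generations at least `k`. -/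
def dyadicWolff {n : ℕ} (p : ℝ) (σ : Measure (En n)) (k : ℕ) (x : En n) : ℝ≥0∞ :=
  ∑' i, wolffCoeff p σ (k + i) (cubeIdx (k + i) x)

lemma measurable_wolffCoeff {n : ℕ} (p : ℝ) (σ : Measure (En n)) (k : ℕ) :
    Measurable fun x => wolffCoeff p σ k (cubeIdx k x) :=
  (measurable_of_countable (wolffCoeff p σ k)).comp (measurable_cubeIdx k)

lemma measurable_dyadicWolff {n : ℕ} (p : ℝ) (σ : Measure (En n)) (k : ℕ) :
    Measurable (dyadicWolff p σ k) :=
  Measurable.tsum fun i => measurable_wolffCoeff p σ (k + i)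

lemma measure_cubeNbhd_eq {n : ℕ} (hn : 2 ≤ n) (σ : Measure (En n)) (k : ℕ) (w : Fin n → ℤ) :
    σ (cubeNbhd k w) = ∫⁻ y in cube k w, dens σ k (cubeIdx k y) * 2 ^ k := by
  have h : ∫⁻ y in cube k w, dens σ k (cubeIdx k y) * 2 ^ k
      = ∫⁻ _y in cube k w, dens σ k w * 2 ^ k :=
    setLIntegral_congr_fun (measurableSet_cube k w) fun y hy => by
      rw [show cubeIdx k y = w from hy]
  rw [h, setLIntegral_const, volume_cube, dens]
  have h2 : k * n = k * (n - 1) + k := by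
    obtain ⟨m, rfl⟩ : ∃ m, n = m + 1 := ⟨n - 1, by omega⟩
    simp; ring
  rw [h2, pow_add]
  calc σ (cubeNbhd k w)
      = σ (cubeNbhd k w) * ((2 ^ (k * (n - 1)) * 2 ^ k) * (2 ^ (k * (n - 1)) * 2 ^ k)⁻¹) := by
        rw [ENNReal.mul_inv_cancel (by simp) (ENNReal.mul_ne_top (by simp) (by simp)), mul_one]
    _ = _ := by ring

lemma setLIntegral_dyadicWolff_pow_le {n : ℕ} (hn : 2 ≤ n) {p : ℝ} {σ : Measure (En n)}
    {A : ℝ≥0∞}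
    (hA : ∀ (k N : ℕ) (z : Fin n → ℤ), ∑ i ∈ Finset.range N, ∫⁻ y in cube k z,
        dens σ (k + i) (cubeIdx (k + i) y) ^ (1 / (p - 1)) * dens σ (k + i) (cubeIdx (k + i) y)
      ≤ A * σ (cubeNbhd k z)) (m k : ℕ) (z : Fin n → ℤ) :
    ∫⁻ x in cube k z, dyadicWolff p σ k x ^ m ∂σ ≤ m.factorial * A ^ m * σ (cubeNbhd k z) := by
  induction m generalizing k z with
  | zero => simpa using measure_mono (cube_subset_cubeNbhd k z)
  | succ m ih =>
    set c : ℝ≥0∞ := m.factorial * A ^ m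
    have hpt : ∀ x, dyadicWolff p σ k x ^ (m + 1) ≤ (m + 1) * ∑' i,
        wolffCoeff p σ (k + i) (cubeIdx (k + i) x) * dyadicWolff p σ (k + i) x ^ m := by
      intro x
      refine (tsum_pow_succ_le m fun i => wolffCoeff p σ (k + i) (cubeIdx (k + i) x)).trans_eq ?_
      simp only [dyadicWolff, add_assoc]
    have hgm : ∀ j, Measurable fun y : En n => c * (dens σ j (cubeIdx j y) * 2 ^ j) := fun j =>
      ((measurable_dens σ j).mul_const _).const_mul _
    have hterm : ∀ i, ∫⁻ x in cube k z,
        wolffCoeff p σ (k + i) (cubeIdx (k + i) x) * dyadicWolff p σ (k + i) x ^ m ∂σ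
        ≤ c * ∫⁻ y in cube k z, dens σ (k + i) (cubeIdx (k + i) y) ^ (1 / (p - 1))
          * dens σ (k + i) (cubeIdx (k + i) y) := by
      intro i
      refine (setLIntegral_cubeIdx_mul_le ((measurable_dyadicWolff p σ (k + i)).pow_const m)
        (hgm (k + i)) (ν := volume) (fun w => ?_) (wolffCoeff p σ (k + i)) z).trans_eq ?_
      · refine (ih (k + i) w).trans_eq ?_
        rw [lintegral_const_mul _ ((measurable_dens σ _).mul_const _), ← measure_cubeNbhd_eq hn]
      · refine Eq.trans (lintegral_congr fun y => ?_)
          (lintegral_const_mul c (((measurable_dens σ _).pow_const _).mul (measurable_dens σ _)))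
        simp only [wolffCoeff]
        set d := dens σ (k + i) (cubeIdx (k + i) y)
        calc d ^ (1 / (p - 1)) * (2 ^ (k + i))⁻¹ * (c * (d * 2 ^ (k + i)))
            = c * (d ^ (1 / (p - 1)) * d) * ((2 ^ (k + i))⁻¹ * 2 ^ (k + i)) := by ring
          _ = _ := by rw [ENNReal.inv_mul_cancel (by simp) (by simp), mul_one]
    have hmeas : ∀ i, Measurable fun x =>
        wolffCoeff p σ (k + i) (cubeIdx (k + i) x) * dyadicWolff p σ (k + i) x ^ m := fun i =>
      (measurable_wolffCoeff p σ (k + i)).mul ((measurable_dyadicWolff p σ (k + i)).pow_const m)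
    calc ∫⁻ x in cube k z, dyadicWolff p σ k x ^ (m + 1) ∂σ
        ≤ ∫⁻ x in cube k z, (m + 1) * ∑' i,
            wolffCoeff p σ (k + i) (cubeIdx (k + i) x) * dyadicWolff p σ (k + i) x ^ m ∂σ :=
          lintegral_mono hpt
      _ = (m + 1) * ∑' i, ∫⁻ x in cube k z,
            wolffCoeff p σ (k + i) (cubeIdx (k + i) x) * dyadicWolff p σ (k + i) x ^ m ∂σ := by
          rw [lintegral_const_mul _ (Measurable.tsum hmeas),
            lintegral_tsum fun i => (hmeas i).aemeasurable]
      _ ≤ (m + 1) * ∑' i, c * ∫⁻ y in cube k z,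
            dens σ (k + i) (cubeIdx (k + i) y) ^ (1 / (p - 1))
              * dens σ (k + i) (cubeIdx (k + i) y) := by
          gcongr with i
          exact hterm i
      _ ≤ (m + 1) * (c * (A * σ (cubeNbhd k z))) := by
          rw [ENNReal.tsum_mul_left]
          gcongr
          exact ENNReal.tsum_le_of_sum_range_le fun N => hA k N z
      _ = _ := by
          simp only [c, Nat.factorial_succ]
          push_cast
          ring

lemma eexp_eq_tsum (a : ℝ≥0∞) : eexp a = ∑' m : ℕ, (m.factorial : ℝ≥0∞)⁻¹ * a ^ m := by
  unfold eexp
  split_ifs with h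
  · refine (top_le_iff.1 ?_).symm
    refine le_trans ?_ (ENNReal.le_tsum 1)
    simp [h]
  · lift a to ℝ≥0 using h
    have hs := NormedSpace.expSeries_div_hasSum_exp (a : ℝ)
    rw [ENNReal.coe_toReal, Real.exp_eq_exp_ℝ, ← hs.tsum_eq,
      ENNReal.ofReal_tsum_of_nonneg (fun m => by positivity) hs.summable]
    refine tsum_congr fun m => ?_
    rw [div_eq_inv_mul, ENNReal.ofReal_mul (by positivity),
      ENNReal.ofReal_inv_of_pos (by positivity), ENNReal.ofReal_pow (by positivity)]
    simp

lemma setLIntegral_eexp_dyadicWolff_lt_top {n : ℕ} (hn : 2 ≤ n) {p : ℝ} {σ : Measure (En n)}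
    [IsLocallyFiniteMeasure σ] {A b : ℝ≥0∞}
    (hA : ∀ (k N : ℕ) (z : Fin n → ℤ), ∑ i ∈ Finset.range N, ∫⁻ y in cube k z,
        dens σ (k + i) (cubeIdx (k + i) y) ^ (1 / (p - 1)) * dens σ (k + i) (cubeIdx (k + i) y)
      ≤ A * σ (cubeNbhd k z)) (hAb : b * A < 1) (k : ℕ) (z : Fin n → ℤ) :
    ∫⁻ x in cube k z, eexp (b * dyadicWolff p σ k x) ∂σ < ∞ := by
  have hm : ∀ m : ℕ, Measurable fun x => (m.factorial : ℝ≥0∞)⁻¹ * (b * dyadicWolff p σ k x) ^ m :=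
    fun m => (((measurable_dyadicWolff p σ k).const_mul b).pow_const m).const_mul _
  simp only [eexp_eq_tsum]
  rw [lintegral_tsum fun m => (hm m).aemeasurable]
  calc ∑' m : ℕ, ∫⁻ x in cube k z, (m.factorial : ℝ≥0∞)⁻¹ * (b * dyadicWolff p σ k x) ^ m ∂σ
      ≤ ∑' m : ℕ, (b * A) ^ m * σ (cubeNbhd k z) := by
        gcongr with m
        simp only [mul_pow]
        rw [lintegral_const_mul _ (((measurable_dyadicWolff p σ k).pow_const m).const_mul _),
          lintegral_const_mul _ ((measurable_dyadicWolff p σ k).pow_const m)]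
        calc (m.factorial : ℝ≥0∞)⁻¹ * (b ^ m * ∫⁻ x in cube k z, dyadicWolff p σ k x ^ m ∂σ)
            ≤ (m.factorial : ℝ≥0∞)⁻¹ * (b ^ m * (m.factorial * A ^ m * σ (cubeNbhd k z))) := by
              gcongr
              exact setLIntegral_dyadicWolff_pow_le hn hA m k z
          _ = ((m.factorial : ℝ≥0∞)⁻¹ * m.factorial) * (b ^ m * A ^ m * σ (cubeNbhd k z)) := by ring
          _ = _ := by
              rw [ENNReal.inv_mul_cancel (by simp [Nat.factorial_ne_zero]) (by simp), one_mul]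
    _ = (1 - b * A)⁻¹ * σ (cubeNbhd k z) := by
        rw [ENNReal.tsum_mul_right, ENNReal.tsum_geometric]
    _ < ∞ := ENNReal.mul_lt_top (by simpa using hAb) (isBounded_cubeNbhd k z).measure_lt_top

lemma wolffT_one_le {n : ℕ} (hn : 2 ≤ n) {p : ℝ} (hp : 1 < p) (hpn : p < n) (σ : Measure (En n))
    (x : En n) :
    wolffT n 1 p σ 1 x ≤ 2 ^ (((n:ℝ) - p) / (p - 1)) * dyadicWolff p σ 0 x := by
  have hp1 : 0 < p - 1 := by linarith
  set g : ℝ → ℝ≥0∞ := fun r =>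
    (σ (ball x r) / ENNReal.ofReal (r ^ ((n:ℝ) - 1 * p))) ^ (1 / (p - 1)) * ENNReal.ofReal r⁻¹
  have hcover : Ioo (0:ℝ) 1 ⊆ ⋃ j : ℕ, Ioc ((1 / 2 : ℝ) ^ (j + 1)) ((1 / 2) ^ j) := by
    intro r hr
    obtain ⟨j, h1, h2⟩ := exists_nat_pow_near_of_lt_one hr.1 hr.2.le (show (0:ℝ) < 1 / 2 by norm_num)
      (by norm_num)
    exact mem_iUnion.2 ⟨j, h1, h2⟩
  have hpow : ∀ j : ℕ, ENNReal.ofReal (((1 / 2 : ℝ) ^ (j + 1)) ^ ((n:ℝ) - 1 * p))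
      = 2 ^ (-((j + 1 : ℝ) * (n - p))) := by
    intro j
    rw [← ENNReal.ofReal_rpow_of_pos (by positivity), ENNReal.ofReal_pow (by norm_num),
      ← ENNReal.rpow_natCast_mul]
    rw [one_div, ENNReal.ofReal_inv_of_pos (by norm_num), ENNReal.inv_rpow, ← ENNReal.rpow_neg]
    simp
  have hterm : ∀ j : ℕ, ∫⁻ r in Ioc ((1 / 2 : ℝ) ^ (j + 1)) ((1 / 2) ^ j), g r
      ≤ 2 ^ (((n:ℝ) - p) / (p - 1)) * wolffCoeff p σ j (cubeIdx j x) := by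
    intro j
    set N := σ (cubeNbhd j (cubeIdx j x)) with hN
    calc ∫⁻ r in Ioc ((1 / 2 : ℝ) ^ (j + 1)) ((1 / 2) ^ j), g r
        ≤ ∫⁻ _r in Ioc ((1 / 2 : ℝ) ^ (j + 1)) ((1 / 2) ^ j),
          (N / 2 ^ (-((j + 1 : ℝ) * (n - p)))) ^ (1 / (p - 1))
            * ENNReal.ofReal (((1 / 2 : ℝ) ^ (j + 1))⁻¹) := by
          refine setLIntegral_mono measurable_const fun r hr => ?_
          have hr0 : (0:ℝ) < (1 / 2) ^ (j + 1) := by positivity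
          rw [← hpow]
          simp only [g]
          gcongr
          · exact measure_mono (ball_subset_cubeNbhd (by simpa using hr.2))
          · linarith
          · exact hr.1.le
          · exact hr.1.le
      _ = (N / 2 ^ (-((j + 1 : ℝ) * (n - p)))) ^ (1 / (p - 1)) := by
          rw [setLIntegral_const, Real.volume_Ioc, mul_assoc, ← ENNReal.ofReal_mul (by positivity)]
          have : ((1 / 2 : ℝ) ^ (j + 1))⁻¹ * ((1 / 2) ^ j - (1 / 2) ^ (j + 1)) = 1 := by
            field_simp
            ring
          rw [this, ENNReal.ofReal_one, mul_one]
      _ = 2 ^ (((n:ℝ) - p) / (p - 1)) * wolffCoeff p σ j (cubeIdx j x) := by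
          have h2 : (2:ℝ≥0∞) ≠ 0 := by simp
          have h2' : (2:ℝ≥0∞) ≠ ∞ := by simp
          have hs : (0:ℝ) ≤ 1 / (p - 1) := by positivity
          rw [wolffCoeff, dens, ← hN, div_eq_mul_inv, ← ENNReal.rpow_neg, neg_neg,
            ENNReal.mul_rpow_of_nonneg _ _ hs, ENNReal.mul_rpow_of_nonneg _ _ hs,
            ← ENNReal.rpow_mul, ← ENNReal.rpow_natCast_mul]
          have h3 : ((2:ℝ≥0∞) ^ j)⁻¹ = 2 ^ (-(j:ℝ)) := by
            rw [ENNReal.rpow_neg, ENNReal.rpow_natCast]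
          have h4 : (j + 1 : ℝ) * (n - p) * (1 / (p - 1))
              = (n - p) / (p - 1) + (((j * (n - 1) : ℕ) : ℝ) * (1 / (p - 1)) + -(j:ℝ)) := by
            push_cast [show 1 ≤ n by omega]
            field_simp
            ring
          rw [h3, h4, ENNReal.rpow_add _ _ h2 h2', ENNReal.rpow_add _ _ h2 h2']
          ring
  calc wolffT n 1 p σ 1 x ≤ ∫⁻ r in ⋃ j : ℕ, Ioc ((1 / 2 : ℝ) ^ (j + 1)) ((1 / 2) ^ j), g r :=
        lintegral_mono_set hcover
    _ ≤ ∑' j : ℕ, ∫⁻ r in Ioc ((1 / 2 : ℝ) ^ (j + 1)) ((1 / 2) ^ j), g r := lintegral_iUnion_le _ _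
    _ ≤ ∑' j : ℕ, 2 ^ (((n:ℝ) - p) / (p - 1)) * wolffCoeff p σ j (cubeIdx j x) :=
        ENNReal.tsum_le_tsum hterm
    _ = _ := by simp [ENNReal.tsum_mul_left, dyadicWolff]

lemma setLIntegral_Ioo_potential_le {n : ℕ} {σ : Measure (En n)} {x : En n} {R ρ q e : ℝ}
    {U : ℝ≥0∞} (hρ : ρ ≤ R) (hq : 0 ≤ q) (he : 0 ≤ e)
    (hU : ∀ r < R, σ (ball x r) ≤ U) :
    ∫⁻ r in Ioo 0 ρ, (σ (ball x r) / ENNReal.ofReal (r ^ q)) ^ e * ENNReal.ofReal r⁻¹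
      ≤ (∫⁻ r in Ioo (0:ℝ) 1, (σ (ball x r) / ENNReal.ofReal (r ^ q)) ^ e * ENNReal.ofReal r⁻¹)
        + U ^ e * ENNReal.ofReal (R - 1) := by
  have hsub : Ioo 0 ρ ⊆ Ioo 0 1 ∪ Ico 1 R := by
    intro r hr
    rcases lt_or_ge r 1 with h | h
    · exact Or.inl ⟨hr.1, h⟩
    · exact Or.inr ⟨h, hr.2.trans_le hρ⟩
  refine (lintegral_mono_set hsub).trans ((lintegral_union_le _ _ _).trans ?_)
  gcongr
  calc ∫⁻ r in Ico 1 R, (σ (ball x r) / ENNReal.ofReal (r ^ q)) ^ e * ENNReal.ofReal r⁻¹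
      ≤ ∫⁻ _r in Ico 1 R, U ^ e := by
        refine setLIntegral_mono measurable_const fun r hr => ?_
        have h1 : 1 ≤ ENNReal.ofReal (r ^ q) :=
          ENNReal.one_le_ofReal.2 (Real.one_le_rpow hr.1 hq)
        have h2 : ENNReal.ofReal r⁻¹ ≤ 1 := ENNReal.ofReal_le_one.2 (inv_le_one_of_one_le₀ hr.1)
        calc _ ≤ (U / 1) ^ e * 1 := by
              gcongr
              exact hU r hr.2
          _ = U ^ e := by simp
    _ = _ := by rw [setLIntegral_const, Real.volume_Ico]

lemma eexp_top : eexp ∞ = ∞ := if_pos rfl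

lemma eexp_of_ne_top {a : ℝ≥0∞} (ha : a ≠ ∞) : eexp a = ENNReal.ofReal (Real.exp a.toReal) :=
  if_neg ha

lemma eexp_ne_zero (a : ℝ≥0∞) : eexp a ≠ 0 := by
  by_cases ha : a = ∞
  · simp [ha, eexp_top]
  · simp [eexp_of_ne_top ha, Real.exp_pos]

lemma eexp_mono {a b : ℝ≥0∞} (h : a ≤ b) : eexp a ≤ eexp b := by
  by_cases hb : b = ∞
  · simp [hb, eexp_top]
  · rw [eexp_of_ne_top hb, eexp_of_ne_top (ne_top_of_le_ne_top hb h)]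
    gcongr

lemma eexp_add (a b : ℝ≥0∞) : eexp (a + b) = eexp a * eexp b := by
  by_cases ha : a = ∞
  · simp [ha, eexp_top, ENNReal.top_mul (eexp_ne_zero b)]
  by_cases hb : b = ∞
  · simp [hb, eexp_top, ENNReal.mul_top (eexp_ne_zero a)]
  rw [eexp_of_ne_top ha, eexp_of_ne_top hb, eexp_of_ne_top (ENNReal.add_ne_top.2 ⟨ha, hb⟩),
    ENNReal.toReal_add ha hb, Real.exp_add, ENNReal.ofReal_mul (Real.exp_pos _).le]

lemma eexp_rpow {p : ℝ} (hp : 0 < p) (a : ℝ≥0∞) : eexp a ^ p = eexp (ENNReal.ofReal p * a) := by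
  by_cases ha : a = ∞
  · have : ENNReal.ofReal p ≠ 0 := by simpa using hp
    simp [ha, eexp_top, ENNReal.mul_top this, hp]
  · rw [eexp_of_ne_top ha, eexp_of_ne_top (ENNReal.mul_ne_top (by simp) ha),
      ENNReal.ofReal_rpow_of_pos (Real.exp_pos _), ← Real.exp_mul, ENNReal.toReal_mul,
      ENNReal.toReal_ofReal hp.le, mul_comm]

lemma exists_finset_subset_iUnion_cube {n : ℕ} (k : ℕ) {K : Set (En n)} (hK : Bornology.IsBounded K) :
    ∃ S : Finset (Fin n → ℤ), K ⊆ ⋃ z ∈ S, cube k z := by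
  obtain ⟨R, hR⟩ := hK.exists_norm_le
  refine ⟨Finset.Icc (fun _ => ⌊-(2 ^ k * R)⌋) (fun _ => ⌊2 ^ k * R⌋), fun x hx => ?_⟩
  have h : ∀ i, |x i| ≤ R := fun i => by
    simpa using (PiLp.norm_apply_le x i).trans (hR x hx)
  refine mem_iUnion₂.2 ⟨cubeIdx k x, ?_, rfl⟩
  rw [Finset.mem_Icc]
  refine ⟨fun i => Int.floor_le_floor ?_, fun i => Int.floor_le_floor ?_⟩
  · rw [← mul_neg]
    gcongr
    exact (abs_le.1 (h i)).1
  · gcongr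
    exact (abs_le.1 (h i)).2

lemma rieszConst_ne_zero {n : ℕ} (hn : 2 ≤ n) : rieszConst n ≠ 0 := by
  have h1 : (2:ℝ) ≤ n := by exact_mod_cast hn
  rw [rieszConst, ← ENNReal.ofReal_mul (by positivity), Ne, ENNReal.ofReal_eq_zero, not_le]
  have : (0:ℝ) < n - 1 := by linarith
  positivity

/-- A smallness threshold for the capacitary constant guaranteeing the testing condition with a
prescribed small constant. -/
lemma exists_threshold {n : ℕ} (hn : 2 ≤ n) {p : ℝ} (hp : 1 < p) {b : ℝ≥0∞} (hb0 : b ≠ 0)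
    (hb : b ≠ ∞) :
    ∃ C₀ : ℝ, 0 < C₀ ∧ ∃ t : ℝ≥0∞, t ≠ 0 ∧ t ≠ ∞ ∧ b * (2 * (rieszConst n * t)) < 1 ∧
      ∀ C : ℝ, C < C₀ →
        rieszConst n * (2 * (1 - 2 ^ (1 - p))⁻¹ * t ^ (1 - p) * ENNReal.ofReal C) ≤ 2⁻¹ := by
  have hr0 := rieszConst_ne_zero hn
  have hr : rieszConst n ≠ ∞ := by
    rw [rieszConst]
    finiteness
  set a := 2 * b * 2 * rieszConst n with ha
  have ha0 : a ≠ 0 := by simp [ha, hb0, hr0]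
  have ha' : a ≠ ∞ := by finiteness
  have ht0 : a⁻¹ ≠ 0 := ENNReal.inv_ne_zero.2 ha'
  have ht : a⁻¹ ≠ ∞ := ENNReal.inv_ne_top.2 ha0
  set D : ℝ≥0∞ := (1 - 2 ^ (1 - p))⁻¹ with hD
  have hD0 : D ≠ 0 := ENNReal.inv_ne_zero.2 (ENNReal.sub_ne_top (by simp))
  have hD' : D ≠ ∞ := by
    refine ENNReal.inv_ne_top.2 (tsub_pos_of_lt ?_).ne'
    exact ENNReal.rpow_lt_one_of_one_lt_of_neg (by norm_num) (by linarith)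
  have hs0 : a⁻¹ ^ (1 - p) ≠ 0 := (ENNReal.rpow_pos (pos_iff_ne_zero.2 ht0) ht).ne'
  have hs : a⁻¹ ^ (1 - p) ≠ ∞ := ENNReal.rpow_ne_top_of_ne_zero ht0 ht
  set κ := rieszConst n * (2 * D * a⁻¹ ^ (1 - p)) with hκ
  have hκ0 : κ ≠ 0 := by simp [hκ, hr0, hD0, hs0]
  have hκ' : κ ≠ ∞ := by finiteness
  have hC0 : (2 * κ)⁻¹ ≠ 0 := ENNReal.inv_ne_zero.2 (by finiteness)
  have hC : (2 * κ)⁻¹ ≠ ∞ := ENNReal.inv_ne_top.2 (by simp [hκ0])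
  refine ⟨((2 * κ)⁻¹).toReal, ENNReal.toReal_pos hC0 hC, a⁻¹, ht0, ht, ?_, fun C hlt => ?_⟩
  · have h2 : 2 * (b * (2 * (rieszConst n * a⁻¹))) = 1 := by
      rw [← ENNReal.mul_inv_cancel ha0 ha', ha]
      ring
    have h3 : b * (2 * (rieszConst n * a⁻¹)) = 2⁻¹ :=
      ENNReal.eq_inv_of_mul_eq_one_left (by rw [mul_comm]; exact h2)
    rw [h3]
    exact ENNReal.inv_lt_one.2 (by norm_num)
  · calc rieszConst n * (2 * D * a⁻¹ ^ (1 - p) * ENNReal.ofReal C) = κ * ENNReal.ofReal C := by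
          rw [hκ]; ring
      _ ≤ κ * (2 * κ)⁻¹ := by
          gcongr
          rw [← ENNReal.ofReal_toReal hC]
          exact ENNReal.ofReal_le_ofReal hlt.le
      _ = 2⁻¹ := by
          rw [ENNReal.mul_inv (by simp) (by simp), mul_left_comm, ENNReal.mul_inv_cancel hκ0 hκ',
            mul_one]

lemma vp_rpow_le {n : ℕ} (hn : 2 ≤ n) {p : ℝ} (hp : 1 < p) (hpn : p < n) (B c : ℝ)
    {σ : Measure (En n)} [IsLocallyFiniteMeasure σ] {x₀ : En n} (hσ : rieszT n 1 p σ 1 x₀ < ∞)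
    {δ : ℝ} (hδ : 0 < δ) (R : ℝ) :
    ∃ M : ℝ≥0∞, M ≠ ∞ ∧ ∀ x, δ ≤ ‖x - x₀‖ → ‖x - x₀‖ ≤ R →
      vp n p B c σ x₀ x ^ p ≤ M * eexp (ENNReal.ofReal p
        * (ENNReal.ofReal c * 2 ^ (((n:ℝ) - p) / (p - 1))) * dyadicWolff p σ 0 x) := by
  have hp0 : 0 < p := by linarith
  have hp1 : 0 < p - 1 := by linarith
  have he : 0 ≤ 1 / (p - 1) := by positivity
  have hq : 0 ≤ (n:ℝ) - 1 * p := by linarith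
  set U := σ (ball x₀ (R + R)) with hU
  have hUfin : U ≠ ∞ := measure_ball_lt_top.ne
  set M₁ := U ^ (1 / (p - 1)) * ENNReal.ofReal (R - 1) with hM₁
  have hM₁' : M₁ ≠ ∞ :=
    ENNReal.mul_ne_top (ENNReal.rpow_ne_top_of_nonneg he hUfin) (by simp)
  set M₂ := rieszT n 1 p σ 1 x₀ + U ^ (1:ℝ) * ENNReal.ofReal (R - 1) with hM₂
  have hM₂' : M₂ ≠ ∞ := by
    refine ENNReal.add_ne_top.2 ⟨hσ.ne, ENNReal.mul_ne_top ?_ (by simp)⟩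
    simpa using hUfin
  set P : ℝ≥0∞ := ENNReal.ofReal B * ENNReal.ofReal δ ^ ((p - (n:ℝ)) / (p - 1)) with hP
  have hP' : P ≠ ∞ := ENNReal.mul_ne_top (by simp)
    (ENNReal.rpow_ne_top_of_ne_zero (by simpa using hδ) (by simp))
  set T := ENNReal.ofReal p * (ENNReal.ofReal c * M₁ + ENNReal.ofReal c * M₂) with hT
  have hT' : T ≠ ∞ := by finiteness
  refine ⟨P ^ p * eexp T, ENNReal.mul_ne_top (ENNReal.rpow_ne_top_of_nonneg hp0.le hP')
    (by simp [eexp_of_ne_top hT']), fun x hδx hxR => ?_⟩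
  have hW : wolffT n 1 p σ ‖x - x₀‖ x
      ≤ 2 ^ (((n:ℝ) - p) / (p - 1)) * dyadicWolff p σ 0 x + M₁ := by
    refine (setLIntegral_Ioo_potential_le (R := R) (U := U) hxR hq he fun r hr =>
      measure_mono ?_).trans (add_le_add_left (wolffT_one_le hn hp hpn σ x) _)
    refine ball_subset_ball' ?_
    rw [dist_eq_norm]
    linarith
  have hI : rieszT n 1 p σ ‖x - x₀‖ x₀ ≤ M₂ := by
    have := setLIntegral_Ioo_potential_le (σ := σ) (x := x₀) (R := R) (U := U) hxR hq zero_le_one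
      fun r hr => measure_mono (ball_subset_ball (by linarith [norm_nonneg (x - x₀)]))
    simpa only [hM₂, rieszT, ENNReal.rpow_one] using this
  have hneg : (ENNReal.ofReal ‖x - x₀‖) ^ ((p - (n:ℝ)) / (p - 1))
      ≤ ENNReal.ofReal δ ^ ((p - (n:ℝ)) / (p - 1)) := by
    have he' : (p - (n:ℝ)) / (p - 1) = -(((n:ℝ) - p) / (p - 1)) := by ring
    rw [he', ENNReal.rpow_neg, ENNReal.rpow_neg]
    exact ENNReal.inv_le_inv.2 (ENNReal.rpow_le_rpow (ENNReal.ofReal_le_ofReal hδx)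
      (div_nonneg (by linarith) hp1.le))
  calc vp n p B c σ x₀ x ^ p
      ≤ (P * eexp (ENNReal.ofReal c * (2 ^ (((n:ℝ) - p) / (p - 1)) * dyadicWolff p σ 0 x + M₁)
          + ENNReal.ofReal c * M₂)) ^ p := by
        rw [vp, hP]
        gcongr
        exact eexp_mono (by gcongr)
    _ = P ^ p * eexp (T + ENNReal.ofReal p
        * (ENNReal.ofReal c * 2 ^ (((n:ℝ) - p) / (p - 1))) * dyadicWolff p σ 0 x) := by
        rw [ENNReal.mul_rpow_of_nonneg _ _ hp0.le, eexp_rpow hp0, hT]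
        congr 2
        ring
    _ = _ := by rw [eexp_add, ← mul_assoc (P ^ p)]

/-- Lemma `lpsigmaest`: with `C(σ) = sup_E σ(E)/cap_{1,p}(E) < ∞` and
`∫_0^1 σ(B(x₀,r))/r^{n-p} dr/r < ∞`, there is `C₀ = C₀(n,p,c) > 0` such that if `C(σ) < C₀`
then `v ∈ L^p_loc(ℝⁿ \ {x₀}, dσ)`. -/
theorem statement16 (n : ℕ) (hn : 2 ≤ n) (p : ℝ) (hp : 1 < p) (hpn : p < n)
    (B c : ℝ) (hB : 0 < B) (hc : 0 < c) :
    ∃ C₀ : ℝ, 0 < C₀ ∧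
      ∀ σ : Measure (En n), IsLocallyFiniteMeasure σ →
        ∀ (x₀ : En n) (Cσ : ℝ), 0 < Cσ →
          (∀ E : Set (En n), IsCompact E → σ E ≤ ENNReal.ofReal Cσ * rieszCap n 1 p E) →
          rieszT n 1 p σ 1 x₀ < ∞ →
          Cσ < C₀ →
          ∀ K : Set (En n), IsCompact K → x₀ ∉ K →
            ∫⁻ x in K, (vp n p B c σ x₀ x) ^ p ∂σ < ∞ := by
  set b : ℝ≥0∞ := ENNReal.ofReal p * (ENNReal.ofReal c * 2 ^ (((n:ℝ) - p) / (p - 1))) with hb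
  have hp0 : 0 < p := by linarith
  have hb0 : b ≠ 0 := by
    have : (2:ℝ≥0∞) ^ (((n:ℝ) - p) / (p - 1)) ≠ 0 :=
      (ENNReal.rpow_pos (by norm_num) (by simp)).ne'
    simp [hb, hp0, hc, this]
  have hb' : b ≠ ∞ := by
    have : (2:ℝ≥0∞) ^ (((n:ℝ) - p) / (p - 1)) ≠ ∞ :=
      ENNReal.rpow_ne_top_of_ne_zero (by simp) (by simp)
    finiteness
  obtain ⟨C₀, hC₀, t, ht0, ht, hbt, hthr⟩ := exists_threshold hn hp hb0 hb'
  refine ⟨C₀, hC₀, fun σ _ x₀ Cσ _ hcap hriesz hlt K hK hx₀ => ?_⟩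
  obtain ⟨S, hS⟩ := exists_finset_subset_iUnion_cube 0 hK.isBounded
  have hdist : ∃ δ > 0, ∀ x ∈ K, δ ≤ ‖x - x₀‖ := by
    obtain ⟨δ, hδ, hsub⟩ := Metric.mem_nhds_iff.1 (hK.isClosed.isOpen_compl.mem_nhds hx₀)
    refine ⟨δ, hδ, fun x hx => not_lt.1 fun hlt => hsub ?_ hx⟩
    rwa [mem_ball, dist_eq_norm]
  obtain ⟨δ, hδ, hδK⟩ := hdist
  obtain ⟨R, hR⟩ := hK.isBounded.subset_closedBall x₀
  obtain ⟨M, hM, hvp⟩ := vp_rpow_le hn hp hpn B c hriesz hδ R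
  have hA := sum_setLIntegral_dens_le hn hp hcap ht0 ht (hthr Cσ hlt)
  calc ∫⁻ x in K, vp n p B c σ x₀ x ^ p ∂σ
      ≤ ∫⁻ x in K, M * eexp (b * dyadicWolff p σ 0 x) ∂σ :=
        setLIntegral_mono' hK.measurableSet fun x hx =>
          hvp x (hδK x hx) (by simpa [dist_eq_norm] using hR hx)
    _ = M * ∫⁻ x in K, eexp (b * dyadicWolff p σ 0 x) ∂σ := lintegral_const_mul' _ _ hM
    _ ≤ M * ∑ z ∈ S, ∫⁻ x in cube 0 z, eexp (b * dyadicWolff p σ 0 x) ∂σ := by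
        have hdisj : Set.PairwiseDisjoint (↑S) (cube (n := n) 0) := fun z _ w _ hzw =>
          Set.disjoint_left.2 fun x hz hw => hzw (hz.symm.trans hw)
        rw [← lintegral_biUnion_finset hdisj fun z _ => measurableSet_cube 0 z]
        gcongr
    _ < ∞ := ENNReal.mul_lt_top hM.lt_top <| ENNReal.sum_lt_top.2 fun z _ =>
        setLIntegral_eexp_dyadicWolff_lt_top hn hA hbt 0 z
end
end
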